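/- arXiv:2510.01572 — 4 statements merged into one kernel-verified Lean document; each statement's English description precedes it below -/
import Mathlib

section
/- For all integers n ≥ 0, a_5(27n + 19) ≡ 0 (mod 3). -/
/-- The set of `k`-colored-odd partitions of `n`: multisets of pairs `(m, c)` with
`m` a positive integer and `c ∈ {1, …, k}`, such that `c = 1` whenever `m` is even,
and the parts `m` sum (with multiplicity) to `n`. -/
def coloredOddPartitions (k n : ℕ) : Set (Multiset (ℕ × ℕ)) :=
  {s | (∀ p ∈ s, 0 < p.1 ∧ 1 ≤ p.2 ∧ p.2 ≤ k ∧ (Even p.1 → p.2 = 1)) ∧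
    (s.map Prod.fst).sum = n}

/-- `a k n` is the number of `k`-colored-odd partitions of `n`. -/
noncomputable def a (k n : ℕ) : ℕ := Nat.card (coloredOddPartitions k n)

open PowerSeries Finset

namespace CO

/-- power series over `ZMod 3` -/
abbrev S := PowerSeries (ZMod 3)

instance fact3 : Fact (Nat.Prime 3) := ⟨Nat.prime_three⟩

/-- formal convergence -/
def Conv (p : ℕ → S) (f : S) : Prop := ∀ d : ℕ, ∃ N : ℕ, ∀ n ≥ N, (X : S) ^ d ∣ p n - f

theorem Conv.unique {p : ℕ → S} {f g : S} (hf : Conv p f) (hg : Conv p g) : f = g := by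
  ext d
  obtain ⟨N, hN⟩ := hf (d + 1)
  obtain ⟨M, hM⟩ := hg (d + 1)
  have h1 := hN (max N M) (le_max_left _ _)
  have h2 := hM (max N M) (le_max_right _ _)
  have h3 := dvd_sub h2 h1
  rw [X_pow_dvd_iff] at h3
  have := h3 d (Nat.lt_succ_self d)
  simp only [map_sub] at this
  linear_combination this

theorem Conv.mul {p q : ℕ → S} {f g : S} (hf : Conv p f) (hg : Conv q g) :
    Conv (fun n => p n * q n) (f * g) := by
  intro d
  obtain ⟨N, hN⟩ := hf d
  obtain ⟨M, hM⟩ := hg d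
  refine ⟨max N M, fun n hn => ?_⟩
  have h1 := hN n (le_trans (le_max_left _ _) hn)
  have h2 := hM n (le_trans (le_max_right _ _) hn)
  have : p n * q n - f * g = p n * (q n - g) + g * (p n - f) := by ring
  rw [this]
  exact dvd_add (h2.mul_left _) (h1.mul_left _)

theorem Conv.add {p q : ℕ → S} {f g : S} (hf : Conv p f) (hg : Conv q g) :
    Conv (fun n => p n + q n) (f + g) := by
  intro d
  obtain ⟨N, hN⟩ := hf d
  obtain ⟨M, hM⟩ := hg d
  refine ⟨max N M, fun n hn => ?_⟩
  have h1 := hN n (le_trans (le_max_left _ _) hn)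
  have h2 := hM n (le_trans (le_max_right _ _) hn)
  have : p n + q n - (f + g) = (p n - f) + (q n - g) := by ring
  rw [this]
  exact dvd_add h1 h2

theorem Conv.const (f : S) : Conv (fun _ => f) f := fun d => ⟨0, fun n _ => by simp⟩

theorem Conv.comp {p : ℕ → S} {f : S} (hf : Conv p f) (s : ℕ → ℕ) (hs : ∀ n, n ≤ s n) :
    Conv (fun n => p (s n)) f := by
  intro d
  obtain ⟨N, hN⟩ := hf d
  exact ⟨N, fun n hn => hN _ (le_trans hn (hs n))⟩

theorem Conv.congr {p q : ℕ → S} {f : S} (hf : Conv p f) (h : ∀ n, p n = q n) : Conv q f := by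
  have : p = q := funext h
  rwa [← this]

/-- expand by 3 -/
noncomputable def e : S →ₐ[ZMod 3] S := expand 3 (by norm_num)

theorem e_X : e (X : S) = X ^ 3 := expand_X 3 (by norm_num)

theorem Conv.e {p : ℕ → S} {f : S} (hf : Conv p f) : Conv (fun n => e (p n)) (e f) := by
  intro d
  obtain ⟨N, hN⟩ := hf d
  refine ⟨N, fun n hn => ?_⟩
  have := map_dvd CO.e (hN n hn)
  rw [map_sub, map_pow, e_X] at this
  refine dvd_trans ?_ this
  rw [← pow_mul]
  exact pow_dvd_pow _ (by omega)

/-- partial product -/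
noncomputable def ep (x Q : S) (n : ℕ) : S := ∏ i ∈ range n, (1 + x * Q ^ i)

/-- infinite product -/
noncomputable def E (x Q : S) : S := PowerSeries.mk fun d => coeff d (ep x Q (d + 1))

theorem ep_stable {x Q : S} (hQ : X ∣ Q) {d m n : ℕ} (hm : d ≤ m) (hn : m ≤ n) :
    (X : S) ^ d ∣ ep x Q n - ep x Q m := by
  induction n, hn using Nat.le_induction with
  | base => simp
  | succ n hn ih =>
    have : ep x Q (n + 1) - ep x Q m = (ep x Q n - ep x Q m) + ep x Q n * x * Q ^ n := by
      simp only [ep, prod_range_succ]; ring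
    rw [this]
    refine dvd_add ih (Dvd.dvd.mul_left ?_ _)
    exact (pow_dvd_pow _ (by omega : d ≤ n)).trans (pow_dvd_pow_of_dvd hQ n)

theorem conv_E {x Q : S} (hQ : X ∣ Q) : Conv (ep x Q) (E x Q) := by
  intro d
  refine ⟨d, fun n hn => ?_⟩
  rw [X_pow_dvd_iff]
  intro m hm
  have h := ep_stable (x := x) hQ (le_refl (m + 1)) (show m + 1 ≤ n by omega)
  rw [X_pow_dvd_iff] at h
  have := h m (by omega)
  simpa [E] using this

theorem E_split2 {x Q : S} (hQ : X ∣ Q) : E x Q = E x (Q ^ 2) * E (x * Q) (Q ^ 2) := by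
  have hQ2 : X ∣ Q ^ 2 := dvd_pow hQ (by norm_num)
  refine ((conv_E hQ).comp (fun n => 2 * n) (fun n => by omega)).unique ?_
  refine ((conv_E (x := x) hQ2).mul (conv_E (x := x * Q) hQ2)).congr fun n => ?_
  induction n with
  | zero => simp [ep]
  | succ n ih =>
    rw [show 2 * (n + 1) = 2 * n + 1 + 1 by ring]
    simp only [ep, prod_range_succ] at *
    rw [← ih]; ring

theorem E_split3 {x Q : S} (hQ : X ∣ Q) :
    E x Q = E x (Q ^ 3) * E (x * Q) (Q ^ 3) * E (x * Q ^ 2) (Q ^ 3) := by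
  have hQ2 : X ∣ Q ^ 3 := dvd_pow hQ (by norm_num)
  refine ((conv_E hQ).comp (fun n => 3 * n) (fun n => by omega)).unique ?_
  refine (((conv_E (x := x) hQ2).mul (conv_E (x := x * Q) hQ2)).mul
    (conv_E (x := x * Q ^ 2) hQ2)).congr fun n => ?_
  induction n with
  | zero => simp [ep]
  | succ n ih =>
    rw [show 3 * (n + 1) = 3 * n + 1 + 1 + 1 by ring]
    simp only [ep, prod_range_succ] at *
    rw [← ih]; ring

theorem E_pm {x Q : S} (hQ : X ∣ Q) : E x Q * E (-x) Q = E (-x ^ 2) (Q ^ 2) := by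
  have hQ2 : X ∣ Q ^ 2 := dvd_pow hQ (by norm_num)
  refine ((conv_E hQ).mul (conv_E hQ)).unique ?_
  refine (conv_E (x := -x ^ 2) hQ2).congr fun n => ?_
  simp only [ep, ← prod_mul_distrib]
  refine prod_congr rfl fun i _ => ?_
  ring

theorem E_shift {x Q : S} (hQ : X ∣ Q) : E x Q = (1 + x) * E (x * Q) Q := by
  refine ((conv_E hQ).comp (fun n => n + 1) (fun n => by omega)).unique ?_
  refine ((Conv.const (1 + x)).mul (conv_E (x := x * Q) hQ)).congr fun n => ?_
  simp only [ep, prod_range_succ']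
  simp only [pow_zero, mul_one]
  rw [mul_comm]
  congr 1
  refine prod_congr rfl fun i _ => ?_
  ring

theorem three_zero : (3 : S) = 0 := by
  have h : (3 : ZMod 3) = 0 := by decide
  have := congrArg (PowerSeries.C (R := ZMod 3)) h
  rw [map_zero] at this
  rw [← this]
  exact (map_ofNat (PowerSeries.C (R := ZMod 3)) 3).symm

theorem e_E {x Q : S} (hQ : X ∣ Q) : e (E x Q) = E (e x) (e Q) := by
  have hQ2 : X ∣ e Q := by
    have := map_dvd e hQ
    rw [e_X] at this
    exact (dvd_pow_self _ (by norm_num)).trans this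
  refine (conv_E hQ).e.unique ?_
  refine (conv_E (x := e x) hQ2).congr fun n => ?_
  simp [ep, map_prod]

theorem E_cube {x Q : S} (hQ : X ∣ Q) : E x Q ^ 3 = E (x ^ 3) (Q ^ 3) := by
  have hQ2 : X ∣ Q ^ 3 := dvd_pow hQ (by norm_num)
  rw [show E x Q ^ 3 = E x Q * E x Q * E x Q by ring]
  refine (((conv_E hQ).mul (conv_E hQ)).mul (conv_E hQ)).unique ?_
  refine (conv_E (x := x ^ 3) hQ2).congr fun n => ?_
  simp only [ep, ← prod_mul_distrib]
  refine prod_congr rfl fun i _ => ?_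
  linear_combination (-(x * Q ^ i) - (x * Q ^ i) ^ 2) * three_zero

/-! ### q-binomials -/

/-- Gaussian binomial -/
noncomputable def gb (Q : S) : ℕ → ℕ → S
  | _, 0 => 1
  | 0, _ + 1 => 0
  | n + 1, k + 1 => gb Q n k + Q ^ (k + 1) * gb Q n (k + 1)

theorem gb_zero (Q : S) (n : ℕ) : gb Q n 0 = 1 := by cases n <;> rfl

theorem gb_succ (Q : S) (n k : ℕ) :
    gb Q (n + 1) (k + 1) = gb Q n k + Q ^ (k + 1) * gb Q n (k + 1) := rfl

theorem gb_lt (Q : S) : ∀ n k : ℕ, n < k → gb Q n k = 0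
  | _, 0, h => by omega
  | 0, k + 1, _ => rfl
  | n + 1, k + 1, h => by
    rw [gb_succ, gb_lt Q n k (by omega), gb_lt Q n (k + 1) (by omega)]; simp

theorem gb_self (Q : S) (n : ℕ) : gb Q n n = 1 := by
  induction n with
  | zero => rfl
  | succ n ih => rw [gb_succ, ih, gb_lt Q n (n + 1) (by omega)]; simp

/-- (Q;Q)_n -/
noncomputable def pp (Q : S) (n : ℕ) : S := ep (-Q) Q n

theorem pp_succ (Q : S) (n : ℕ) : pp Q (n + 1) = pp Q n * (1 - Q ^ (n + 1)) := by
  simp only [pp, ep, prod_range_succ]; ring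

theorem pp_gb (Q : S) : ∀ i j : ℕ, pp Q i * pp Q j * gb Q (i + j) j = pp Q (i + j)
  | i, 0 => by simp [gb_zero, pp, ep]
  | 0, j + 1 => by
    rw [zero_add, gb_self]; simp [pp, ep]
  | i + 1, j + 1 => by
    have h1 := pp_gb Q (i + 1) j
    have h2 := pp_gb Q i (j + 1)
    rw [show i + 1 + (j + 1) = (i + j + 1) + 1 by ring, gb_succ, pp_succ Q (i + j + 1)]
    rw [show i + 1 + j = i + j + 1 by ring] at h1
    rw [show i + (j + 1) = i + j + 1 by ring] at h2
    rw [pp_succ Q i] at *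
    rw [pp_succ Q j] at *
    linear_combination (1 - Q ^ (j + 1)) * h1 + Q ^ (j + 1) * (1 - Q ^ (i + 1)) * h2

theorem isUnit_pp {Q : S} (hQ : X ∣ Q) (n : ℕ) : IsUnit (pp Q n) := by
  rw [PowerSeries.isUnit_iff_constantCoeff]
  rw [X_dvd_iff] at hQ
  simp [pp, ep, map_prod, hQ]

theorem gb_succ' {Q : S} (hQ : X ∣ Q) (i k : ℕ) :
    gb Q (i + k + 1) (k + 1) = Q ^ i * gb Q (i + k) k + gb Q (i + k) (k + 1) := by
  cases i with
  | zero => rw [zero_add, gb_self, gb_self, gb_lt Q k (k + 1) (by omega)]; simp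
  | succ i =>
    apply ((isUnit_pp hQ (i + 1)).mul (isUnit_pp hQ (k + 1))).mul_left_cancel
    have h0 := pp_gb Q (i + 1) (k + 1)
    have h1 := pp_gb Q (i + 1) k
    have h2 := pp_gb Q i (k + 1)
    rw [show i + (k + 1) = i + 1 + k by ring] at h2
    rw [show i + 1 + (k + 1) = i + 1 + k + 1 by ring, pp_succ Q (i + 1 + k)] at h0
    rw [h0]
    rw [pp_succ Q i] at *
    rw [pp_succ Q k] at *
    linear_combination -(Q ^ (i + 1) * (1 - Q ^ (k + 1))) * h1 - (1 - Q ^ (i + 1)) * h2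

theorem pp_gb_approx {Q : S} (hQ : X ∣ Q) {d i j n : ℕ} (hi : d ≤ i) (hj : d ≤ j) (hn : d ≤ n) :
    (X : S) ^ d ∣ pp Q n * gb Q (i + j) j - 1 := by
  have h0 := pp_gb Q i j
  have key : ∀ m, d ≤ m → (X : S) ^ d ∣ pp Q m - pp Q d := fun m hm =>
    ep_stable hQ le_rfl hm
  have hu := (isUnit_pp hQ i).mul (isUnit_pp hQ j)
  rw [← hu.dvd_mul_left]
  have : pp Q i * pp Q j * (pp Q n * gb Q (i + j) j - 1)
      = (pp Q (i + j) - pp Q d) * pp Q n + pp Q d * (pp Q n - pp Q d)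
        - ((pp Q i - pp Q d) * pp Q j + pp Q d * (pp Q j - pp Q d)) := by
    linear_combination pp Q n * h0
  rw [this]
  exact dvd_sub (dvd_add ((key _ (by omega)).mul_right _) ((key _ hn).mul_left _))
    (dvd_add ((key _ hi).mul_right _) ((key _ hj).mul_left _))

/-- triangular numbers -/
def u (k : ℤ) : ℕ := (k * (k + 1) / 2).toNat

theorem two_u (k : ℤ) : 2 * (u k : ℤ) = k * (k + 1) := by
  have h0 : 0 ≤ k * (k + 1) := by
    rcases le_or_gt 0 k with h | h
    · positivity
    · nlinarith
  have h1 := Int.even_mul_succ_self k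
  obtain ⟨r, hr⟩ := h1
  unfold u
  omega

/-- theta term -/
noncomputable def w (x y : S) (k : ℤ) : S := x ^ u k * y ^ u (k - 1)

theorem u_step (k : ℤ) : (u (k + 1) : ℤ) = u k + k + 1 := by
  have h1 := two_u k
  have h2 := two_u (k + 1)
  linarith

theorem w_x (x y : S) (m i : ℕ) (k : ℤ) (h : (m : ℤ) = i + k) :
    x * (x * y) ^ m * w x y k = (x * y) ^ i * w x y (k + 1) := by
  have h1 := u_step k
  have h2 := u_step (k - 1)
  rw [sub_add_cancel] at h2
  have e1 : 1 + m + u k = i + u (k + 1) := by omega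
  have e2 : m + u (k - 1) = i + u k := by omega
  unfold w
  rw [add_sub_cancel_right, mul_pow, mul_pow]
  calc _ = x ^ (1 + m + u k) * y ^ (m + u (k - 1)) := by ring
    _ = _ := by rw [e1, e2]; ring

theorem w_y (x y : S) (n j : ℕ) (k : ℤ) (h : (j : ℤ) = n + k) :
    y * (x * y) ^ n * w x y k = (x * y) ^ j * w x y (k - 1) := by
  have h1 := u_step (k - 1)
  have h2 := u_step (k - 1 - 1)
  rw [sub_add_cancel] at h1 h2
  have e1 : n + u k = j + u (k - 1) := by omega
  have e2 : 1 + n + u (k - 1) = j + u (k - 1 - 1) := by omega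
  unfold w
  rw [mul_pow, mul_pow]
  calc _ = x ^ (n + u k) * y ^ (1 + n + u (k - 1)) := by ring
    _ = _ := by rw [e1, e2]; ring

theorem finite_y (x y : S) (n : ℕ) :
    ep y (x * y) n = ∑ j ∈ range (n + 1), gb (x * y) n j * w x y (j - n) := by
  induction n with
  | zero => simp [ep, gb_zero, w, u]
  | succ n ih =>
    have hL : ep y (x * y) (n + 1) = ep y (x * y) n + y * (x * y) ^ n * ep y (x * y) n := by
      simp only [ep, prod_range_succ]; ring
    rw [hL, ih, sum_range_succ' _ (n + 1)]
    have hS : y * (x * y) ^ n * ∑ j ∈ range (n + 1), gb (x * y) n j * w x y (j - n)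
        = ∑ j ∈ range (n + 1 + 1), (x * y) ^ j * gb (x * y) n j * w x y (j - n - 1) := by
      rw [sum_range_succ _ (n + 1), gb_lt _ n (n + 1) (by omega), mul_zero, zero_mul, add_zero,
        mul_sum]
      refine sum_congr rfl fun j _ => ?_
      have := w_y x y n j (j - n) (by ring)
      linear_combination gb (x * y) n j * this
    rw [hS, sum_range_succ' _ (n + 1), ← add_assoc, ← sum_add_distrib]
    congr 1
    · refine sum_congr rfl fun j _ => ?_
      rw [gb_succ]
      push_cast
      rw [show (j : ℤ) + 1 - n - 1 = j - n by ring, show (j : ℤ) + 1 - (n + 1) = j - n by ring]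
      ring
    · rw [gb_zero, gb_zero]
      push_cast
      rw [show (0 : ℤ) - n - 1 = 0 - (n + 1) by ring]
      simp

theorem finite_jtp {x y : S} (hy : X ∣ y) (m n : ℕ) :
    ep x (x * y) m * ep y (x * y) n
      = ∑ j ∈ range (m + n + 1), gb (x * y) (m + n) j * w x y (j - n) := by
  have hQ : X ∣ x * y := hy.mul_left _
  induction m with
  | zero => rw [zero_add, ← finite_y]; simp [ep]
  | succ m ih =>
    have hL : ep x (x * y) (m + 1) * ep y (x * y) n
        = ep x (x * y) m * ep y (x * y) n
          + x * (x * y) ^ m * (ep x (x * y) m * ep y (x * y) n) := by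
      simp only [ep, prod_range_succ]; ring
    rw [hL, ih]
    rw [show m + 1 + n = m + n + 1 by ring]
    set N := m + n with hN
    have hS : ∑ j ∈ range (N + 1), gb (x * y) N j * w x y (j - n)
        = ∑ j ∈ range (N + 1), gb (x * y) N (j + 1) * w x y (j + 1 - n) + w x y (0 - n) := by
      have h1 := sum_range_succ (fun j : ℕ => gb (x * y) N j * w x y (j - n)) (N + 1)
      rw [gb_lt _ N (N + 1) (by omega), zero_mul, add_zero, sum_range_succ'] at h1
      rw [← h1, gb_zero]
      push_cast
      simp
    rw [mul_sum, sum_range_succ' _ (N + 1)]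
    nth_rw 1 [hS]
    rw [gb_zero, add_right_comm, ← sum_add_distrib]
    congr 1
    · refine sum_congr rfl fun j hj => ?_
      have hj' : j ≤ N := by rw [mem_range] at hj; omega
      obtain ⟨i, hi⟩ := Nat.exists_eq_add_of_le' hj'
      have h1 := gb_succ' hQ i j
      rw [← hi] at h1
      rw [h1]
      have h2 := w_x x y m i (j - n) (by omega)
      push_cast
      rw [show (j : ℤ) + 1 - n = j - n + 1 by ring]
      linear_combination gb (x * y) N j * h2
    · push_cast; simp

/-- theta product -/
noncomputable def Th (x y : S) : S := E x (x * y) * E y (x * y) * E (-(x * y)) (x * y)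

/-- theta partial sum -/
noncomputable def ts (x y : S) (n : ℕ) : S := ∑ j ∈ range (2 * n + 1), w x y (j - n)

theorem conv_Th {x y : S} (hy : X ∣ y) : Conv (ts x y) (Th x y) := by
  have hQ : X ∣ x * y := hy.mul_left _
  have h0 := ((conv_E (x := x) hQ).mul (conv_E (x := y) hQ)).mul (conv_E (x := -(x * y)) hQ)
  intro d
  obtain ⟨N, hN⟩ := h0 d
  refine ⟨max N (2 * d), fun n hn => ?_⟩
  have h1 := hN n (le_trans (le_max_left _ _) hn)
  have h2 : 2 * d ≤ n := le_trans (le_max_right _ _) hn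
  have : ts x y n - Th x y
      = (ep x (x * y) n * ep y (x * y) n * ep (-(x * y)) (x * y) n - Th x y)
        - (ep x (x * y) n * ep y (x * y) n * pp (x * y) n - ts x y n) := by
    simp only [pp]; ring
  rw [this]
  refine dvd_sub h1 ?_
  rw [finite_jtp hy, ts, sum_mul, ← two_mul, ← sum_sub_distrib]
  refine dvd_sum fun j hj => ?_
  have hj' : j < 2 * n + 1 := mem_range.1 hj
  have : gb (x * y) (2 * n) j * w x y (j - n) * pp (x * y) n - w x y (j - n)
      = (pp (x * y) n * gb (x * y) (2 * n) j - 1) * w x y (j - n) := by ring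
  rw [this]
  by_cases hd : d ≤ u ((j : ℤ) - n - 1)
  · refine Dvd.dvd.mul_left (Dvd.dvd.mul_left ?_ _) _
    exact (pow_dvd_pow _ hd).trans (pow_dvd_pow_of_dvd hy _)
  · refine Dvd.dvd.mul_right ?_ _
    have hu := two_u ((j : ℤ) - n - 1)
    have hlt : (u ((j : ℤ) - n - 1) : ℤ) + 1 ≤ d := by omega
    set k : ℤ := (j : ℤ) - n with hk
    have ha : k ≤ d := by nlinarith [sq_nonneg (k - 1), sq_nonneg (k - 2)]
    have hb : -k ≤ d := by nlinarith [sq_nonneg (k + 1)]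
    obtain ⟨i, hi⟩ := Nat.exists_eq_add_of_le' (show j ≤ 2 * n by omega)
    rw [hi]
    exact pp_gb_approx hQ (by omega) (by omega) (by omega)

theorem Th_comm (x y : S) : Th x y = Th y x := by
  simp only [Th, mul_comm x y, mul_comm (E x _)]

theorem sum_three (h : ℕ → S) (N : ℕ) :
    ∑ j ∈ range (3 * N), h j = ∑ i ∈ range N, (h (3 * i) + h (3 * i + 1) + h (3 * i + 2)) := by
  induction N with
  | zero => simp
  | succ N ih =>
    rw [show 3 * (N + 1) = 3 * N + 1 + 1 + 1 by ring]
    simp only [sum_range_succ]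
    rw [ih]; ring

theorem Th_dissect {x y : S} (hy : X ∣ y) :
    Th x y = Th (x ^ 6 * y ^ 3) (x ^ 3 * y ^ 6) + x * Th (x ^ 9 * y ^ 6) (y ^ 3)
      + y * Th (x ^ 3) (x ^ 6 * y ^ 9) := by
  have h1 : X ∣ x ^ 3 * y ^ 6 := (dvd_pow hy (by norm_num)).mul_left _
  have h2 : X ∣ y ^ 3 := (dvd_pow hy (by norm_num))
  have h3 : X ∣ x ^ 6 * y ^ 9 := (dvd_pow hy (by norm_num)).mul_left _
  refine ((conv_Th (x := x) hy).comp (fun n => 3 * n + 1) (fun n => by omega)).unique ?_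
  refine (((conv_Th (x := x ^ 6 * y ^ 3) h1).add ((Conv.const x).mul
    (conv_Th (x := x ^ 9 * y ^ 6) h2))).add ((Conv.const y).mul
    (conv_Th (x := x ^ 3) h3))).congr fun n => ?_
  simp only [ts]
  rw [show 2 * (3 * n + 1) + 1 = 3 * (2 * n + 1) by ring, sum_three, mul_sum, mul_sum,
    ← sum_add_distrib, ← sum_add_distrib]
  refine sum_congr rfl fun i _ => ?_
  push_cast
  obtain ⟨k, hk⟩ : ∃ k : ℤ, k = (i : ℤ) - n := ⟨_, rfl⟩
  rw [show 3 * (i : ℤ) - (3 * n + 1) = 3 * k - 1 by rw [hk]; ring,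
    show 3 * (i : ℤ) + 1 - (3 * n + 1) = 3 * k by rw [hk]; ring,
    show 3 * (i : ℤ) + 2 - (3 * n + 1) = 3 * k + 1 by rw [hk]; ring, ← hk]
  have a0 := two_u k
  have a1 := two_u (k - 1)
  have b0 := two_u (3 * k)
  have b1 := two_u (3 * k - 1)
  have b2 := two_u (3 * k + 1)
  have b3 := two_u (3 * k - 1 - 1)
  have c0 : u (3 * k) = 6 * u k + 3 * u (k - 1) := by zify; nlinarith
  have c1 : u (3 * k - 1) = 3 * u k + 6 * u (k - 1) := by zify; nlinarith
  have c2 : u (3 * k + 1) = 1 + 9 * u k := by zify; nlinarith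
  have c3 : u (3 * k - 1 - 1) = 1 + 9 * u (k - 1) := by zify; nlinarith
  simp only [w]
  rw [show 3 * k + 1 - 1 = 3 * k by ring, c0, c1, c2, c3]
  ring

/-! ### dissections -/

/-- extract residue class r mod 3 -/
noncomputable def U (r : ℕ) (f : S) : S := PowerSeries.mk fun n => coeff (3 * n + r) f

theorem coeff_e (f : S) (n : ℕ) : coeff n (e f) = if 3 ∣ n then coeff (n / 3) f else 0 :=
  coeff_expand ..

theorem coeff_form (A B C : S) (n : ℕ) :
    coeff n (e A + X * e B + X ^ 2 * e C) =
      if n % 3 = 0 then coeff (n / 3) A else if n % 3 = 1 then coeff (n / 3) B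
        else coeff (n / 3) C := by
  have hX : (X : S) * e B = X ^ 1 * e B := by rw [pow_one]
  rw [hX, map_add, map_add, coeff_X_pow_mul', coeff_X_pow_mul', coeff_e, coeff_e, coeff_e]
  have h : n % 3 = 0 ∨ n % 3 = 1 ∨ n % 3 = 2 := by omega
  split_ifs
  all_goals first
    | (exfalso; omega)
    | (simp only [add_zero, zero_add]; done)
    | (simp only [add_zero, zero_add]; congr 2; omega)

theorem U_form (A B C : S) :
    U 0 (e A + X * e B + X ^ 2 * e C) = A ∧ U 1 (e A + X * e B + X ^ 2 * e C) = B ∧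
      U 2 (e A + X * e B + X ^ 2 * e C) = C := by
  refine ⟨?_, ?_, ?_⟩
  · ext n
    rw [U, coeff_mk, coeff_form, if_pos (by omega)]
    congr 2; omega
  · ext n
    rw [U, coeff_mk, coeff_form, if_neg (by omega), if_pos (by omega)]
    congr 2; omega
  · ext n
    rw [U, coeff_mk, coeff_form, if_neg (by omega), if_neg (by omega)]
    congr 2; omega

theorem form_U (f : S) : f = e (U 0 f) + X * e (U 1 f) + X ^ 2 * e (U 2 f) := by
  ext n
  rw [coeff_form]
  simp only [U, coeff_mk]
  split_ifs <;> congr 2 <;> omega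

theorem U_mul (f g : S) : U 0 (f * e g) = U 0 f * g ∧ U 1 (f * e g) = U 1 f * g ∧
    U 2 (f * e g) = U 2 f * g := by
  have h : f * e g = e (U 0 f * g) + X * e (U 1 f * g) + X ^ 2 * e (U 2 f * g) := by
    conv_lhs => rw [form_U f]
    simp only [map_mul]; ring
  rw [h]
  exact U_form _ _ _

/-! ### the products -/

/-- f_1 -/
noncomputable def f1 : S := E (-X) X
/-- f_2 -/
noncomputable def f2 : S := E (-X ^ 2) (X ^ 2)

theorem dX (n : ℕ) (h : n ≠ 0) : (X : S) ∣ X ^ n := dvd_pow_self _ h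

theorem unit_E {x Q : S} (hx : X ∣ x) : E x Q ≠ 0 := by
  intro h
  have h1 : coeff 0 (E x Q) = 1 := by
    rw [X_dvd_iff] at hx
    simp [E, ep, hx]
  rw [h] at h1
  simp at h1

theorem f1_ne : f1 ≠ 0 := unit_E (by simp)
theorem f2_ne : f2 ≠ 0 := unit_E ((dvd_neg).2 (dX 2 (by norm_num)))

theorem e_f1 : e f1 = f1 ^ 3 := by
  rw [f1, e_E dvd_rfl, E_cube dvd_rfl, map_neg, e_X]
  congr 1; ring

theorem e_f2 : e f2 = f2 ^ 3 := by
  rw [f2, e_E (dX 2 (by norm_num)), E_cube (dX 2 (by norm_num)), map_neg, map_pow, e_X]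
  congr 1 <;> ring

theorem cast_E {x Q x' Q' : S} (h : x = x') (h' : Q = Q') : E x Q = E x' Q' := by rw [h, h']

/-- (q;q^2) -/
noncomputable def od : S := E (-X) (X ^ 2)

theorem od_f2 : od * f2 = f1 := by
  rw [f1, E_split2 dvd_rfl, od, f2]
  congr 1
  exact cast_E (by ring) rfl

/-- phi at minus q -/
noncomputable def ph : S := Th (-X) (-X)
/-- twice psi -/
noncomputable def ps : S := Th 1 X
/-- f(q,q^2) -/
noncomputable def tA : S := Th X (X ^ 2)
/-- f(-q,-q^5) -/
noncomputable def tO : S := Th (-X) (-X ^ 5)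

theorem ph_f2 : ph * f2 = f1 ^ 2 := by
  have : ph = od * od * f2 := by
    simp only [ph, Th, od, f2]
    rw [show (-X : S) * -X = X ^ 2 by ring]
  rw [this, ← od_f2]; ring

theorem ps_f1 : ps * f1 = - f2 ^ 2 := by
  have h1 : E X X * f1 = f2 := E_pm dvd_rfl
  have : ps = 2 * E X X * E X X * f1 := by
    simp only [ps, Th, f1, one_mul]
    rw [E_shift (x := 1) dvd_rfl, one_mul]; ring
  rw [this, ← h1]
  linear_combination (E X X ^ 2 * f1 ^ 2) * three_zero

theorem tA_eq : tA * f2 ^ 3 * f1 = f2 * (f1 ^ 3) ^ 2 := by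
  have h3 : (X : S) ∣ X ^ 3 := dX 3 (by norm_num)
  have h1 : E X X * f1 = f2 := E_pm dvd_rfl
  have h2 : E (X ^ 3) (X ^ 3) * f1 ^ 3 = f2 ^ 3 := by
    rw [← e_f1, ← e_f2, f1, f2, e_E dvd_rfl, e_E (dX 2 (by norm_num))]
    simp only [map_neg, map_pow, e_X]
    rw [E_pm h3]
  have h4 : E X X = E X (X ^ 3) * E (X ^ 2) (X ^ 3) * E (X ^ 3) (X ^ 3) := by
    rw [E_split3 dvd_rfl]
    rw [show (X : S) * X = X ^ 2 by ring, show (X : S) * X ^ 2 = X ^ 3 by ring]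
  have h5 : tA = E X (X ^ 3) * E (X ^ 2) (X ^ 3) * f1 ^ 3 := by
    rw [← e_f1, f1, e_E dvd_rfl, map_neg, e_X]
    simp only [tA, Th]
    rw [show (X : S) * X ^ 2 = X ^ 3 by ring]
  rw [← h2, h5, ← h1, h4]; ring

theorem tO_eq : tO * f1 ^ 3 * f2 = f1 * (f2 ^ 3) ^ 2 := by
  have h6 : (X : S) ∣ X ^ 6 := dX 6 (by norm_num)
  have h2 : E (-X ^ 3) (X ^ 6) * f2 ^ 3 = f1 ^ 3 := by
    rw [← od_f2, mul_pow]
    congr 1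
    rw [od, E_cube (dX 2 (by norm_num))]
    exact cast_E (by ring) (by ring)
  have h4 : od = E (-X) (X ^ 6) * E (-X ^ 3) (X ^ 6) * E (-X ^ 5) (X ^ 6) := by
    rw [od, E_split3 (dX 2 (by norm_num))]
    rw [show (-X : S) * X ^ 2 = -X ^ 3 by ring, show (-X : S) * (X ^ 2) ^ 2 = -X ^ 5 by ring,
      show ((X : S) ^ 2) ^ 3 = X ^ 6 by ring]
  have h5 : tO = E (-X) (X ^ 6) * E (-X ^ 5) (X ^ 6) * f2 ^ 3 := by
    rw [f2, E_cube (dX 2 (by norm_num))]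
    simp only [tO, Th]
    rw [show (-X : S) * -X ^ 5 = X ^ 6 by ring]
    congr 1
    exact cast_E (by ring) (by ring)
  rw [← h2, h5, ← od_f2, h4]; ring

theorem e_Th {x y : S} (hy : X ∣ y) : e (Th x y) = Th (e x) (e y) := by
  have hQ : X ∣ x * y := hy.mul_left _
  simp only [Th, map_mul, e_E hQ, map_neg]

theorem cast_Th {x y x' y' : S} (h : x = x') (h' : y = y') : Th x y = Th x' y' := by rw [h, h']

theorem ph_dis : ph = e (e ph) + X * e tO := by
  have h := Th_dissect (x := -X) (y := -X) (by simp)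
  have h1 : e (e ph) = Th (-X ^ 9) (-X ^ 9) := by
    rw [ph, e_Th (by simp), map_neg, e_X, e_Th (by rw [dvd_neg]; exact dX 3 (by norm_num)),
      map_neg, map_pow, e_X]
    exact cast_Th (by ring) (by ring)
  have h2 : e tO = Th (-X ^ 3) (-X ^ 15) := by
    rw [tO, e_Th (by rw [dvd_neg]; exact dX 5 (by norm_num)), map_neg, map_neg, map_pow, e_X]
    exact cast_Th (by ring) (by ring)
  rw [h1, h2, ph, h]
  rw [show (-X : S) ^ 6 * (-X) ^ 3 = -X ^ 9 by ring, show (-X : S) ^ 3 * (-X) ^ 6 = -X ^ 9 by ring,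
    show (-X : S) ^ 9 * (-X) ^ 6 = -X ^ 15 by ring, show (-X : S) ^ 6 * (-X) ^ 9 = -X ^ 15 by ring,
    show (-X : S) ^ 3 = -X ^ 3 by ring, Th_comm (-X ^ 15)]
  linear_combination (- X * Th (-X ^ 3) (-X ^ 15)) * three_zero

theorem ps_dis : ps = - e tA + X * e (e ps) := by
  have h := Th_dissect (x := 1) (y := X) dvd_rfl
  have h1 : e (e ps) = Th 1 (X ^ 9) := by
    rw [ps, e_Th dvd_rfl, map_one, e_X, e_Th (dX 3 (by norm_num)), map_one, map_pow, e_X]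
    exact cast_Th (by ring) (by ring)
  have h2 : e tA = Th (X ^ 3) (X ^ 6) := by
    rw [tA, e_Th (dX 2 (by norm_num)), map_pow, e_X]
    exact cast_Th (by ring) (by ring)
  rw [h1, h2, ps, h]
  simp only [one_pow, one_mul]
  rw [Th_comm (X ^ 6)]
  linear_combination (Th (X ^ 3) (X ^ 6)) * three_zero

theorem ph_ps : ph * ps = - (f1 * f2) := by
  apply mul_right_cancel₀ (mul_ne_zero f1_ne f2_ne)
  linear_combination (ps * f1) * ph_f2 + f1 ^ 2 * ps_f1

theorem tO_tA : tO * tA = f1 ^ 3 * f2 ^ 3 := by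
  apply mul_right_cancel₀ (mul_ne_zero (mul_ne_zero f1_ne f2_ne)
    (mul_ne_zero (pow_ne_zero 3 f1_ne) (pow_ne_zero 3 f2_ne)))
  linear_combination (tA * f2 ^ 3 * f1) * tO_eq + (f1 * (f2 ^ 3) ^ 2) * tA_eq

theorem G_dis : f1 * f2 = e (e ph * tA) + X * e (- e (f1 * f2)) + X ^ 2 * e (- (tO * e ps)) := by
  have h1 : e (e ph) * e (e ps) = - e (e (f1 * f2)) := by
    rw [← map_mul, ← map_mul, ph_ps, map_neg, map_neg]
  have h2 : e tO * e tA = e (e (f1 * f2)) := by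
    rw [← map_mul, tO_tA, map_mul e f1, e_f1, e_f2]
  have h3 := ph_ps
  rw [ph_dis, ps_dis] at h3
  simp only [map_mul, map_neg] at *
  linear_combination h3 - X * h1 + X * h2 + X * (e (e f1) * e (e f2)) * three_zero

theorem U2_ps : U 2 ps = 0 := by
  have h : ps = e (- tA) + X * e (e ps) + X ^ 2 * e 0 := by
    conv_lhs => rw [ps_dis]
    simp
  rw [h]
  exact (U_form _ _ _).2.2

theorem main_alg {F : S} (hF : F * f1 ^ 5 = f2 ^ 4) : U 2 (U 0 (U 1 F)) = 0 := by
  obtain ⟨g0, g1, -⟩ := U_form (e ph * tA) (- e (f1 * f2)) (- (tO * e ps))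
  rw [← G_dis] at g0 g1
  have s1 : F * e (f1 ^ 2) = (f1 * f2) * e f2 := by
    rw [map_pow, e_f1, e_f2]; linear_combination f1 * hF
  have s2 := congrArg (U 1) s1
  rw [(U_mul _ _).2.1, (U_mul _ _).2.1, g1] at s2
  have s3 : U 1 F * e f1 = (f1 * f2) * e (- (f1 * f2)) := by
    rw [e_f1, map_neg]; linear_combination f1 * s2
  have s4 := congrArg (U 0) s3
  rw [(U_mul _ _).1, (U_mul _ _).1, g0] at s4
  have s5 : U 0 (U 1 F) = (tA * f2) * e (-ph) := by
    apply mul_right_cancel₀ f1_ne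
    rw [s4, map_neg]; ring
  have s6 : (tA * f2) * e f2 = ps * e (- f1 ^ 2) := by
    apply mul_right_cancel₀ f1_ne
    rw [map_neg, map_pow, e_f1, e_f2]
    linear_combination f2 * tA_eq + (f1 ^ 3) ^ 2 * ps_f1
  have s7 := congrArg (U 2) s6
  rw [(U_mul _ _).2.2, (U_mul _ _).2.2, U2_ps, zero_mul] at s7
  have s8 : U 2 (tA * f2) = 0 := (mul_eq_zero.1 s7).resolve_right f2_ne
  rw [s5, (U_mul _ _).2.2, s8, zero_mul]

/-! ### counting -/

/-- multisets supported on a finset with given weight -/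
def MS (T : Finset (ℕ × ℕ)) (n : ℕ) : Set (Multiset (ℕ × ℕ)) :=
  {s | (∀ p ∈ s, p ∈ T) ∧ (s.map Prod.fst).sum = n}

theorem MS_empty_zero : MS ∅ 0 = {0} := by
  ext s
  simp only [MS, Set.mem_ofPred_eq, Set.mem_singleton_iff]
  constructor
  · rintro ⟨h, -⟩
    exact Multiset.eq_zero_of_forall_notMem fun p hp => by simpa using h p hp
  · rintro rfl; simp

theorem MS_empty_pos (n : ℕ) (hn : n ≠ 0) : MS ∅ n = ∅ := by
  ext s
  simp only [MS, Set.mem_ofPred_eq, Set.mem_empty_iff_false, iff_false]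
  rintro ⟨h, h2⟩
  have : s = 0 := Multiset.eq_zero_of_forall_notMem fun p hp => by simpa using h p hp
  subst this
  simp at h2
  exact hn h2.symm

theorem MS_insert (T : Finset (ℕ × ℕ)) (p : ℕ × ℕ) (hp : p ∉ T) (n : ℕ) :
    MS (insert p T) n = MS T n ∪
      (if p.1 ≤ n then (p ::ₘ ·) '' MS (insert p T) (n - p.1) else ∅) := by
  ext s
  simp only [Set.mem_union]
  constructor
  · intro hs
    by_cases h : p ∈ s
    · right
      obtain ⟨t, rfl⟩ := Multiset.exists_cons_of_mem h
      have h2 := hs.2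
      rw [Multiset.map_cons, Multiset.sum_cons] at h2
      rw [if_pos (by omega)]
      refine ⟨t, ⟨fun q hq => hs.1 q (Multiset.mem_cons_of_mem hq), by omega⟩, rfl⟩
    · left
      refine ⟨fun q hq => ?_, hs.2⟩
      have := hs.1 q hq
      rw [Finset.mem_insert] at this
      rcases this with rfl | h'
      · exact absurd hq h
      · exact h'
  · rintro (hs | hs)
    · exact ⟨fun q hq => Finset.mem_insert_of_mem (hs.1 q hq), hs.2⟩
    · split_ifs at hs with h
      · obtain ⟨t, ht, rfl⟩ := hs
        refine ⟨fun q hq => ?_, ?_⟩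
        · rcases Multiset.mem_cons.1 hq with rfl | h'
          · exact Finset.mem_insert_self _ _
          · exact ht.1 q h'
        · have := ht.2
          simp only [Multiset.map_cons, Multiset.sum_cons]
          omega
      · exact absurd hs (Set.notMem_empty _)

theorem MS_finite (T : Finset (ℕ × ℕ)) (hT : ∀ p ∈ T, 0 < p.1) : ∀ n, (MS T n).Finite := by
  induction T using Finset.induction_on with
  | empty =>
    intro n
    rcases eq_or_ne n 0 with rfl | h
    · rw [MS_empty_zero]; exact Set.finite_singleton _
    · rw [MS_empty_pos n h]; exact Set.finite_empty
  | insert p T hp ih =>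
    have ih := ih fun q hq => hT q (Finset.mem_insert_of_mem hq)
    have hp0 := hT p (Finset.mem_insert_self _ _)
    intro n
    induction n using Nat.strong_induction_on with
    | _ n ihn =>
      rw [MS_insert T p hp n]
      refine (ih n).union ?_
      split_ifs with h
      · exact (ihn _ (by omega)).image _
      · exact Set.finite_empty

theorem MS_card (T : Finset (ℕ × ℕ)) (hT : ∀ p ∈ T, 0 < p.1) (p : ℕ × ℕ) (hp : p ∉ T)
    (hp0 : 0 < p.1) (n : ℕ) :
    (MS (insert p T) n).ncard = (MS T n).ncard +
      (if p.1 ≤ n then (MS (insert p T) (n - p.1)).ncard else 0) := by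
  have hT' : ∀ q ∈ insert p T, 0 < q.1 := by
    intro q hq
    rcases Finset.mem_insert.1 hq with rfl | h
    · exact hp0
    · exact hT q h
  conv_lhs => rw [MS_insert T p hp n]
  split_ifs with h
  · rw [Set.ncard_union_eq _ (MS_finite T hT n) ((MS_finite _ hT' _).image _),
      Set.ncard_image_of_injective _ (fun a b hab => (Multiset.cons_inj_right p).1 hab)]
    rw [Set.disjoint_left]
    rintro s hs ⟨t, ht, rfl⟩
    exact hp (hs.1 p (Multiset.mem_cons_self _ _))
  · simp

/-- generating function -/
noncomputable def gf (T : Finset (ℕ × ℕ)) : S := PowerSeries.mk fun n => ((MS T n).ncard : ZMod 3)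

theorem gf_mul (T : Finset (ℕ × ℕ)) (hT : ∀ p ∈ T, 0 < p.1) :
    gf T * ∏ p ∈ T, (1 - X ^ p.1) = 1 := by
  induction T using Finset.induction_on with
  | empty =>
    rw [prod_empty, mul_one]
    ext n
    rw [gf, coeff_mk, coeff_one]
    split_ifs with h
    · rw [h, MS_empty_zero]; simp
    · rw [MS_empty_pos n h]; simp
  | insert p T hp ih =>
    have hT' : ∀ q ∈ T, 0 < q.1 := fun q hq => hT q (Finset.mem_insert_of_mem hq)
    have hp0 := hT p (Finset.mem_insert_self _ _)
    have key : gf (insert p T) = gf T + X ^ p.1 * gf (insert p T) := by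
      ext n
      rw [map_add, coeff_X_pow_mul']
      simp only [gf, coeff_mk]
      rw [MS_card T hT' p hp hp0 n]
      split_ifs <;> simp
    rw [prod_insert hp]
    linear_combination (∏ p ∈ T, (1 - X ^ p.1)) * key + ih hT'

/-- the parts used -/
def TT (M : ℕ) : Finset (ℕ × ℕ) :=
  ((range M ×ˢ range 5).image fun z => (2 * z.1 + 1, z.2 + 1)) ∪
    ((range M).image fun i => (2 * i + 2, 1))

theorem TT_prod (M : ℕ) :
    ∏ p ∈ TT M, (1 - (X : S) ^ p.1) = ep (-X) (X ^ 2) M ^ 5 * ep (-X ^ 2) (X ^ 2) M := by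
  rw [TT, prod_union, prod_image, prod_image, prod_product]
  · simp only [prod_const, card_range, ep, ← prod_pow]
    refine congrArg₂ (· * ·) ?_ ?_
    · refine prod_congr rfl fun i _ => ?_
      rw [show (1 : S) - X ^ (2 * i + 1) = 1 + -X * (X ^ 2) ^ i by ring]
    · refine prod_congr rfl fun i _ => ?_
      ring
  · intro i _ j _ h
    simp at h; exact h
  · rintro ⟨i, c⟩ _ ⟨j, d⟩ _ h
    simp at h ⊢; exact h
  · rw [Finset.disjoint_left]
    intro p h1 h2
    simp only [mem_image, mem_product, mem_range] at h1 h2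
    obtain ⟨z, _, rfl⟩ := h1
    obtain ⟨i, _, h⟩ := h2
    have := congrArg Prod.fst h
    simp at this
    omega

theorem TT_pos (M : ℕ) : ∀ p ∈ TT M, 0 < p.1 := by
  intro p hp
  simp only [TT, mem_union, mem_image, mem_product, mem_range] at hp
  rcases hp with ⟨z, _, rfl⟩ | ⟨i, _, rfl⟩ <;> simp

theorem mem_TT (M : ℕ) (p : ℕ × ℕ) (hp : p.1 ≤ M) :
    p ∈ TT M ↔ (0 < p.1 ∧ 1 ≤ p.2 ∧ p.2 ≤ 5 ∧ (Even p.1 → p.2 = 1)) := by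
  obtain ⟨m, c⟩ := p
  simp only [TT, mem_union, mem_image, mem_product, mem_range, Prod.mk.injEq, Prod.exists] at *
  constructor
  · rintro (⟨i, d, ⟨h1, h2⟩, rfl, rfl⟩ | ⟨i, h1, rfl, rfl⟩)
    · refine ⟨by omega, by omega, by omega, fun h => ?_⟩
      rw [Nat.even_iff] at h; omega
    · refine ⟨by omega, by omega, by omega, fun h => rfl⟩
  · rintro ⟨h1, h2, h3, h4⟩
    rcases Nat.even_or_odd' m with ⟨i, rfl | rfl⟩
    · right
      exact ⟨i - 1, by omega, by omega, (h4 (by simp)).symm⟩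
    · left
      exact ⟨i, c - 1, ⟨by omega, by omega⟩, rfl, by omega⟩

theorem a_eq (M n : ℕ) (h : n ≤ M) : a 5 n = (MS (TT M) n).ncard := by
  have : coloredOddPartitions 5 n = MS (TT M) n := by
    ext s
    simp only [coloredOddPartitions, MS, Set.mem_ofPred_eq]
    refine and_congr_left fun hs => ?_
    refine forall₂_congr fun p hp => ?_
    rw [mem_TT M p]
    refine le_trans ?_ h
    rw [← hs]
    exact Multiset.single_le_sum (fun _ _ => Nat.zero_le _) _ (Multiset.mem_map_of_mem _ hp)
  rw [a, this, Set.ncard_def, Nat.card, Set.encard]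
  rfl

/-- generating function of a_5 -/
noncomputable def F5 : S := PowerSeries.mk fun n => (a 5 n : ZMod 3)

theorem conv_F5 : Conv (fun M => gf (TT M)) F5 := by
  intro d
  refine ⟨d, fun n hn => ?_⟩
  rw [X_pow_dvd_iff]
  intro m hm
  simp only [gf, F5, map_sub, coeff_mk]
  rw [a_eq n m (by omega), sub_self]

theorem F5_eq : F5 * f1 ^ 5 = f2 ^ 4 := by
  have h2 : (X : S) ∣ X ^ 2 := dX 2 (by norm_num)
  have ho := conv_E (x := -X) h2
  have h1 := conv_F5.mul (((((ho.mul ho).mul ho).mul ho).mul ho).mul (conv_E (x := -X ^ 2) h2))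
  have h3 : F5 * (od * od * od * od * od * f2) = 1 := by
    refine h1.unique ((Conv.const 1).congr fun n => ?_)
    rw [← gf_mul (TT n) (TT_pos n), TT_prod]; ring
  rw [← od_f2]
  linear_combination f2 ^ 4 * h3

end CO

theorem stmt9 (n : ℕ) : a 5 (27 * n + 19) ≡ 0 [MOD 3] := by
  have h := congrArg (coeff n) (CO.main_alg CO.F5_eq)
  simp only [CO.U, coeff_mk, CO.F5, map_zero] at h
  rw [← ZMod.natCast_eq_natCast_iff]
  rw [show 3 * (3 * (3 * n + 2) + 0) + 1 = 27 * n + 19 by ring] at h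
  simpa using h
end

section
/- For all integers n ≥ 0, a_5(27n + 10) ≡ a_5(3n + 1) (mod 3). -/
namespace S10
open PowerSeries Finset

abbrev Ser := PowerSeries (ZMod 3)

/-- `X`-adic convergence of a sequence of power series. -/
def Lim (u : ℕ → Ser) (L : Ser) : Prop :=
  ∀ n : ℕ, ∃ M : ℕ, ∀ m, M ≤ m → (X : Ser) ^ n ∣ u m - L

lemma Lim.mul {u v : ℕ → Ser} {L K : Ser} (hu : Lim u L) (hv : Lim v K) :
    Lim (fun m => u m * v m) (L * K) := by
  intro n
  obtain ⟨M, hM⟩ := hu n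
  obtain ⟨N, hN⟩ := hv n
  refine ⟨max M N, fun m hm => ?_⟩
  have h1 := hM m (le_trans (le_max_left _ _) hm)
  have h2 := hN m (le_trans (le_max_right _ _) hm)
  have : u m * v m - L * K = (u m - L) * v m + L * (v m - K) := by ring
  rw [this]
  exact dvd_add (Dvd.dvd.mul_right h1 _) (Dvd.dvd.mul_left h2 _)

lemma Lim.add {u v : ℕ → Ser} {L K : Ser} (hu : Lim u L) (hv : Lim v K) :
    Lim (fun m => u m + v m) (L + K) := by
  intro n
  obtain ⟨M, hM⟩ := hu n
  obtain ⟨N, hN⟩ := hv n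
  refine ⟨max M N, fun m hm => ?_⟩
  have h1 := hM m (le_trans (le_max_left _ _) hm)
  have h2 := hN m (le_trans (le_max_right _ _) hm)
  have : u m + v m - (L + K) = (u m - L) + (v m - K) := by ring
  rw [this]
  exact dvd_add h1 h2

lemma Lim.const (L : Ser) : Lim (fun _ => L) L := fun n => ⟨0, fun m _ => by simp⟩

lemma Lim.neg {u : ℕ → Ser} {L : Ser} (hu : Lim u L) : Lim (fun m => - u m) (- L) := by
  simpa using (Lim.const (-1)).mul hu

lemma Lim.pow {u : ℕ → Ser} {L : Ser} (hu : Lim u L) (k : ℕ) :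
    Lim (fun m => u m ^ k) (L ^ k) := by
  induction k with
  | zero => simpa using Lim.const 1
  | succ k ih => simpa only [pow_succ] using ih.mul hu

lemma Lim.comp {u : ℕ → Ser} {L : Ser} (hu : Lim u L) {φ : ℕ → ℕ} (h : ∀ m, m ≤ φ m + 1) :
    Lim (fun m => u (φ m)) L := by
  intro n
  obtain ⟨M, hM⟩ := hu n
  exact ⟨M + 1, fun m hm => hM _ (by have := h m; omega)⟩

lemma eq_of_dvd {L K : Ser} (h : ∀ n : ℕ, (X : Ser) ^ n ∣ L - K) : L = K := by
  ext n
  have := (X_pow_dvd_iff.1 (h (n + 1))) n (Nat.lt_succ_self n)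
  rw [map_sub] at this
  exact sub_eq_zero.1 this

lemma Lim.unique {u : ℕ → Ser} {L K : Ser} (hu : Lim u L) (hv : Lim u K) : L = K := by
  apply eq_of_dvd
  intro n
  obtain ⟨M, hM⟩ := hu n
  obtain ⟨N, hN⟩ := hv n
  have h1 := hM _ (le_max_left M N)
  have h2 := hN _ (le_max_right M N)
  have := dvd_sub h2 h1
  simpa using this

/-- A sequence whose increments are more and more divisible by `X` converges. -/
noncomputable def lim (u : ℕ → Ser) : Ser := PowerSeries.mk fun n => coeff n (u (n + 1))

lemma dvd_tail {u : ℕ → Ser} (h : ∀ m, (X : Ser) ^ m ∣ u (m + 1) - u m) (m k : ℕ) :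
    (X : Ser) ^ m ∣ u (m + k) - u m := by
  induction k with
  | zero => simp
  | succ k ih =>
    have h1 := (pow_dvd_pow (X : Ser) (Nat.le_add_right m k)).trans (h (m + k))
    have := dvd_add h1 ih
    simpa [add_assoc] using this

lemma dvd_lim {u : ℕ → Ser} (h : ∀ m, (X : Ser) ^ m ∣ u (m + 1) - u m) (m : ℕ) :
    (X : Ser) ^ m ∣ u m - lim u := by
  rw [X_pow_dvd_iff]
  intro n hn
  obtain ⟨k, rfl⟩ := Nat.exists_eq_add_of_le (Nat.succ_le_of_lt hn)
  have := (X_pow_dvd_iff.1 (dvd_tail h (n + 1) k)) n (Nat.lt_succ_self n)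
  simpa [lim] using this

lemma Lim_lim {u : ℕ → Ser} (h : ∀ m, (X : Ser) ^ m ∣ u (m + 1) - u m) : Lim u (lim u) :=
  fun n => ⟨n, fun m hm => (pow_dvd_pow _ hm).trans (dvd_lim h m)⟩

/-! ### Euler products -/

noncomputable def P (k m : ℕ) : Ser := ∏ i ∈ range m, (1 - X ^ (k * (i + 1)))

lemma P_succ (k m : ℕ) : P k (m + 1) = P k m * (1 - X ^ (k * (m + 1))) := by
  simp [P, prod_range_succ]

@[simp] lemma P_zero (k : ℕ) : P k 0 = 1 := by simp [P]

lemma P_step (k : ℕ) (hk : 0 < k) (m : ℕ) : (X : Ser) ^ m ∣ P k (m + 1) - P k m := by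
  rw [P_succ]
  have : P k m * (1 - X ^ (k * (m + 1))) - P k m = X ^ (k * (m + 1)) * (- P k m) := by ring
  rw [this]
  exact Dvd.dvd.mul_right (pow_dvd_pow _ (by nlinarith)) _

noncomputable def f (k : ℕ) : Ser := lim (P k)

lemma Lim_f (k : ℕ) (hk : 0 < k) : Lim (P k) (f k) := Lim_lim (P_step k hk)

lemma dvd_f (k : ℕ) (hk : 0 < k) (m : ℕ) : (X : Ser) ^ m ∣ P k m - f k := dvd_lim (P_step k hk) m

lemma coeff_zero_f (k : ℕ) (hk : 0 < k) : constantCoeff (f k) = 1 := by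
  rw [← coeff_zero_eq_constantCoeff_apply]
  simp [f, lim, P, hk.ne']

lemma f_ne (k : ℕ) (hk : 0 < k) : f k ≠ 0 := by
  intro h
  have := coeff_zero_f k hk
  rw [h] at this
  simp at this

instance : Fact (Nat.Prime 3) := ⟨Nat.prime_three⟩

instance : CharP Ser 3 := by
  have : CharP (ZMod 3) 3 := inferInstance
  exact charP_of_injective_algebraMap (algebraMap (ZMod 3) Ser).injective 3

lemma three_zero : (3 : Ser) = 0 := by
  have := CharP.cast_eq_zero Ser 3
  exact_mod_cast this

lemma f_three (k : ℕ) (hk : 0 < k) : f (k * 3) = f k ^ 3 := by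
  have h1 := (Lim_f k hk).pow 3
  have h2 : (fun m => P k m ^ 3) = P (k * 3) := by
    funext m
    simp only [P, ← prod_pow]
    refine prod_congr rfl fun i _ => ?_
    rw [sub_pow_char, one_pow, ← pow_mul]
    congr 2; ring
  rw [h2] at h1
  exact (Lim_f (k * 3) (by omega)).unique h1

/-! ### Gaussian binomials and a finite Jacobi triple product -/

noncomputable def qb (Q : Ser) : ℕ → ℕ → Ser
  | _, 0 => 1
  | 0, _ + 1 => 0
  | n + 1, k + 1 => qb Q n k + Q ^ (k + 1) * qb Q n (k + 1)

lemma qb_zero (Q : Ser) (n : ℕ) : qb Q n 0 = 1 := by cases n <;> rfl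
lemma qb_succ (Q : Ser) (n k : ℕ) :
    qb Q (n + 1) (k + 1) = qb Q n k + Q ^ (k + 1) * qb Q n (k + 1) := rfl

lemma qb_gt (Q : Ser) (n : ℕ) : ∀ k, n < k → qb Q n k = 0 := by
  induction n with
  | zero => intro k hk; obtain ⟨k, rfl⟩ := Nat.exists_eq_add_of_lt hk; simp [qb]
  | succ n ih =>
    intro k hk
    obtain ⟨k, rfl⟩ : ∃ j, k = j + 1 := ⟨k - 1, by omega⟩
    rw [qb_succ, ih k (by omega), ih (k + 1) (by omega)]; simp

lemma qb_P (d : ℕ) (n : ℕ) : ∀ s t, s + t = n →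
    qb (X ^ d) (s + t) s * P d s * P d t = P d (s + t) := by
  induction n with
  | zero =>
    intro s t h
    obtain rfl : s = 0 := by omega
    obtain rfl : t = 0 := by omega
    simp [qb_zero]
  | succ n ih =>
    intro s t h
    rcases s with _ | s
    · simp [qb_zero]
    rcases t with _ | t
    · have h1 := ih s 0 (by omega)
      simp only [add_zero] at h1 ⊢
      rw [qb_succ, qb_gt _ s (s + 1) (by omega), P_succ]
      simp only [P_zero, mul_one] at h1 ⊢
      linear_combination (1 - X ^ (d * (s + 1))) * h1
    · have h1 := ih s (t + 1) (by omega)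
      have h2 := ih (s + 1) t (by omega)
      have e : s + 1 + t = s + (t + 1) := by omega
      rw [e] at h2
      have e2 : s + 1 + (t + 1) = s + (t + 1) + 1 := by omega
      rw [e2, qb_succ, P_succ d (s + (t + 1))]
      rw [P_succ d s] at h2 ⊢
      rw [P_succ d t] at h1 ⊢
      have e3 : (X : Ser) ^ (d * (s + (t + 1) + 1)) = X ^ (d * (s + 1)) * X ^ (d * (t + 1)) := by
        rw [← pow_add]; congr 1; ring
      rw [e3, ← pow_mul]
      linear_combination (1 - X ^ (d * (s + 1))) * h1
        + X ^ (d * (s + 1)) * (1 - X ^ (d * (t + 1))) * h2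

/-- exponent `a j(j+1)/2 + b j(j-1)/2` -/
def E (a b : ℕ) (j : ℤ) : ℕ := (a * (j * (j + 1) / 2) + b * (j * (j - 1) / 2)).toNat

lemma E_cast (a b : ℕ) (j : ℤ) : 2 * (E a b j : ℤ) = a * (j * (j + 1)) + b * (j * (j - 1)) := by
  obtain ⟨u, hu⟩ : ∃ u, j * (j + 1) = 2 * u := by
    obtain ⟨u, hu⟩ := Int.even_mul_succ_self j
    exact ⟨u, by omega⟩
  obtain ⟨v, hv⟩ : ∃ u, j * (j - 1) = 2 * u := ⟨u - j, by linarith⟩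
  have hu0 : 0 ≤ u := by
    rcases le_or_gt 0 j with h | h <;> nlinarith
  have hv0 : 0 ≤ v := by
    rcases le_or_gt j 0 with h | h <;> nlinarith
  unfold E
  rw [hu, hv]
  simp only [Int.mul_ediv_cancel_left _ (two_ne_zero : (2 : ℤ) ≠ 0)]
  rw [Int.toNat_of_nonneg (by positivity)]
  ring

lemma E_ge (a b : ℕ) (h : 0 < a + b) (j : ℤ) : |j| ≤ E a b j + 1 := by
  have h1 := E_cast a b j
  have hj : 0 ≤ j * (j + 1) := by rcases le_or_gt 0 j with h | h <;> nlinarith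
  have hj' : 0 ≤ j * (j - 1) := by rcases le_or_gt j 0 with h | h <;> nlinarith
  have h3 : j * (j + 1) ≤ 2 * E a b j ∨ j * (j - 1) ≤ 2 * E a b j := by
    rcases Nat.eq_zero_or_pos a with ha | ha
    · right
      have hb : (1 : ℤ) ≤ b := by omega
      have ha : (0 : ℤ) ≤ a := by omega
      nlinarith [mul_nonneg ha hj]
    · left
      have hb : (0 : ℤ) ≤ b := by omega
      have ha : (1 : ℤ) ≤ a := by omega
      nlinarith [mul_nonneg hb hj']
  rcases abs_cases j with ⟨e, h0⟩ | ⟨e, h0⟩ <;> rw [e] <;> rcases h3 with h3 | h3 <;>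
    nlinarith [sq_nonneg (j - 1), sq_nonneg (j + 1), sq_nonneg (j - 2), sq_nonneg (j + 2)]

/-- finite triple product -/
noncomputable def F (a b m : ℕ) : Ser :=
  (∏ i ∈ range m, (1 + X ^ (a + (a + b) * i))) * ∏ i ∈ range m, (1 + X ^ (b + (a + b) * i))

lemma qbinom (d M : ℕ) : ∀ a : ℕ, ∏ i ∈ range M, ((1 : Ser) + X ^ (a + d * i)) =
    ∑ n ∈ range (M + 1), qb (X ^ d) M n * X ^ (a * n + d * (n.choose 2)) := by
  induction M with
  | zero => intro a; simp [qb_zero]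
  | succ M ih =>
    intro a
    rw [prod_range_succ']
    have e : ∀ i, a + d * (i + 1) = (a + d) + d * i := fun i => by ring
    simp only [e]
    rw [ih (a + d), sum_range_succ' _ (M + 1)]
    simp only [qb_succ, qb_zero, add_mul, sum_add_distrib]
    have h1 : ∑ n ∈ range (M + 1), qb (X ^ d) M n * (X : Ser) ^ (a * n + d * n + d * n.choose 2)
        = ∑ n ∈ range (M + 1), (X ^ d) ^ (n + 1) * qb (X ^ d) M (n + 1) *
          (X : Ser) ^ (a * (n + 1) + d * (n + 1).choose 2) + 1 := by
      have : ∑ n ∈ range (M + 2), qb (X ^ d) M n * (X : Ser) ^ (a * n + d * n + d * n.choose 2) =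
        ∑ n ∈ range (M + 1), qb (X ^ d) M n * (X : Ser) ^ (a * n + d * n + d * n.choose 2) := by
        rw [sum_range_succ _ (M + 1), qb_gt _ M (M + 1) (by omega)]; simp
      rw [← this, sum_range_succ']
      congr 1
      · refine sum_congr rfl fun n _ => ?_
        rw [mul_comm ((X ^ d) ^ (n + 1)), mul_assoc, ← pow_mul, ← pow_add]
        congr 2; ring
      · simp [qb_zero]
    have h2 : (∑ n ∈ range (M + 1), qb (X ^ d) M n * (X : Ser) ^ (a * n + d * n + d * n.choose 2))
        * X ^ a = ∑ n ∈ range (M + 1), qb (X ^ d) M n *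
          (X : Ser) ^ (a * (n + 1) + d * (n + 1).choose 2) := by
      rw [sum_mul]
      refine sum_congr rfl fun n _ => ?_
      rw [mul_assoc, ← pow_add, Nat.choose_succ_succ' n 1, Nat.choose_one_right]
      congr 2; ring
    rw [mul_add, mul_one]
    simp only [mul_zero, add_zero, Nat.choose_zero_succ, pow_zero, mul_one]
    rw [h2, h1]
    ring

lemma fin_jtp (a b M N : ℕ) : (∏ i ∈ range M, ((1 : Ser) + X ^ (a + (a + b) * i))) *
    ∏ i ∈ range N, (1 + X ^ (b + (a + b) * i)) =
    ∑ n ∈ range (M + N + 1), qb (X ^ (a + b)) (M + N) n * X ^ (E a b ((n : ℤ) - N)) := by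
  induction N with
  | zero =>
    simp only [range_zero, prod_empty, mul_one, add_zero]
    rw [qbinom]
    refine sum_congr rfl fun n _ => ?_
    congr 2
    have h := E_cast a b ((n : ℤ) - (0 : ℕ))
    have h2 : 2 * ((n.choose 2 : ℕ) : ℤ) = n * (n - 1) := by
      have := Nat.triangle_succ
      have h3 := Nat.choose_two_right n
      have h4 : 2 * n.choose 2 = n * (n - 1) := by
        rw [h3, Nat.mul_div_cancel' (Nat.even_mul_pred_self n).two_dvd]
      rcases n with _ | n
      · simp
      · simp only [Nat.add_sub_cancel] at h4
        push_cast
        have : (2 * ((n+1).choose 2 : ℕ) : ℤ) = (n + 1) * n := by exact_mod_cast h4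
        linarith
    zify
    push_cast at h
    have : 2 * ((a : ℤ) * n + (a + b) * (n.choose 2 : ℕ)) = 2 * (E a b ((n : ℤ) - 0)) := by
      rw [h]; linear_combination ((a : ℤ) + b) * h2
    push_cast
    linarith
  | succ N ih =>
    rw [prod_range_succ, ← mul_assoc, ih]
    have e0 : M + (N + 1) = M + N + 1 := by omega
    rw [e0]
    generalize M + N = K at ih ⊢
    rw [sum_range_succ' _ (K + 1)]
    simp only [qb_succ, qb_zero, add_mul, sum_add_distrib]
    have c1 : ∀ n : ℕ, ((n + 1 : ℕ) : ℤ) - ((N + 1 : ℕ) : ℤ) = n - N := by intro n; push_cast; ring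
    simp only [c1]
    rw [mul_add, mul_one, add_assoc]
    congr 1
    have h1 : ∑ n ∈ range (K + 1), (X ^ (a + b)) ^ (n + 1) * qb (X ^ (a + b)) K (n + 1) *
          (X : Ser) ^ (E a b ((n : ℤ) - N)) + 1 * X ^ (E a b (((0 : ℕ) : ℤ) - ((N + 1 : ℕ) : ℤ))) =
        ∑ n ∈ range (K + 2), (X ^ (a + b)) ^ n * qb (X ^ (a + b)) K n *
          (X : Ser) ^ (E a b ((n : ℤ) - (N + 1 : ℕ))) := by
      rw [sum_range_succ' _ (K + 1)]
      simp only [c1, qb_zero, pow_zero, one_mul]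
    rw [h1, sum_range_succ _ (K + 1), qb_gt _ K (K + 1) (by omega)]
    simp only [mul_zero, zero_mul, add_zero]
    rw [sum_mul]
    refine sum_congr rfl fun n _ => ?_
    rw [mul_assoc, mul_comm ((X ^ (a + b)) ^ n), mul_assoc, ← pow_mul, ← pow_add, ← pow_add]
    congr 2
    have hA := E_cast a b ((n : ℤ) - N)
    have hB := E_cast a b ((n : ℤ) - (N + 1 : ℕ))
    zify
    push_cast at hB ⊢
    have : 2 * ((E a b ((n : ℤ) - N) : ℤ) + (b + (a + b) * N)) =
      2 * ((a + b) * n + E a b ((n : ℤ) - (N + 1))) := by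
      linear_combination hA - hB
    linarith

/-! ### Theta series -/

noncomputable def S (a b m : ℕ) : Ser :=
  X ^ (E a b 0) + ∑ i ∈ range m, (X ^ (E a b ((i : ℤ) + 1)) + X ^ (E a b (-((i : ℤ) + 1))))

lemma S_succ (a b m : ℕ) : S a b (m + 1) = S a b m +
    (X ^ (E a b ((m : ℤ) + 1)) + X ^ (E a b (-((m : ℤ) + 1)))) := by
  rw [S, sum_range_succ, S]; ring

lemma S_step (a b : ℕ) (h : 0 < a + b) (m : ℕ) : (X : Ser) ^ m ∣ S a b (m + 1) - S a b m := by
  rw [S_succ, add_sub_cancel_left]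
  have h1 := E_ge a b h ((m : ℤ) + 1)
  have h2 := E_ge a b h (-((m : ℤ) + 1))
  rw [abs_neg] at h2
  rw [abs_of_nonneg (by positivity)] at h1 h2
  exact dvd_add (pow_dvd_pow _ (by omega)) (pow_dvd_pow _ (by omega))

noncomputable def theta (a b : ℕ) : Ser := lim (S a b)

lemma Lim_theta (a b : ℕ) (h : 0 < a + b) : Lim (S a b) (theta a b) := Lim_lim (S_step a b h)

lemma sum_shift (g : ℤ → Ser) (m : ℕ) : ∑ n ∈ range (m + m + 1), g ((n : ℤ) - m) =
    g 0 + ∑ i ∈ range m, (g ((i : ℤ) + 1) + g (-((i : ℤ) + 1))) := by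
  induction m with
  | zero => simp
  | succ m ih =>
    have e : m + 1 + (m + 1) + 1 = (m + m + 1) + 1 + 1 := by omega
    rw [e, sum_range_succ, sum_range_succ', sum_range_succ _ m, ← add_assoc, ← ih]
    have c1 : ∀ n : ℕ, ((n + 1 : ℕ) : ℤ) - ((m + 1 : ℕ) : ℤ) = n - m := by intro n; push_cast; ring
    simp only [c1]
    have c2 : ((0 : ℕ) : ℤ) - ((m + 1 : ℕ) : ℤ) = -((m : ℤ) + 1) := by push_cast; ring
    have c3 : (((m + m + 1 : ℕ) : ℤ)) - (m : ℤ) = (m : ℤ) + 1 := by push_cast; ring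
    rw [c2, c3]
    ring

lemma jtp_dvd (a b : ℕ) (h : 0 < a + b) (m : ℕ) :
    (X : Ser) ^ m ∣ X * (F a b m * f (a + b) ^ 2 - f (a + b) * S a b m) := by
  have hS : S a b m = ∑ n ∈ range (m + m + 1), X ^ (E a b ((n : ℤ) - m)) :=
    (sum_shift (fun j => X ^ (E a b j)) m).symm
  rw [F, fin_jtp, hS, sum_mul, mul_sum, ← sum_sub_distrib, mul_sum]
  refine dvd_sum fun n hn => ?_
  rw [mem_range] at hn
  obtain ⟨t, ht⟩ : ∃ t, m + m = n + t := ⟨m + m - n, by omega⟩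
  rw [ht]
  have hq := qb_P (a + b) _ n t rfl
  have h1 := dvd_f (a + b) h n
  have h2 := dvd_f (a + b) h t
  have h3 := dvd_f (a + b) h (n + t)
  set I := f (a + b)
  set q := qb (X ^ (a + b)) (n + t) n
  have hge := E_ge a b h ((n : ℤ) - m)
  have key : (X : Ser) ^ (min n t) ∣ q * I ^ 2 - I := by
    have e : q * I ^ 2 - I = -(q * I) * (P (a + b) n - I) - q * P (a + b) n * (P (a + b) t - I)
      + (P (a + b) (n + t) - I) := by rw [← hq]; ring
    rw [e]
    refine dvd_add (dvd_sub ?_ ?_) ?_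
    · exact Dvd.dvd.mul_left ((pow_dvd_pow _ (min_le_left _ _)).trans h1) _
    · exact Dvd.dvd.mul_left ((pow_dvd_pow _ (min_le_right _ _)).trans h2) _
    · exact (pow_dvd_pow _ (by omega)).trans h3
  have e : X * (q * X ^ (E a b ((n : ℤ) - m)) * I ^ 2 - I * X ^ (E a b ((n : ℤ) - m))) =
    (q * I ^ 2 - I) * X ^ (E a b ((n : ℤ) - m) + 1) := by ring
  rw [e]
  have h4 : m ≤ min n t + (E a b ((n : ℤ) - m) + 1) := by
    rcases abs_cases ((n : ℤ) - m) with ⟨e, h0⟩ | ⟨e, h0⟩ <;> rw [e] at hge <;> omega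
  refine (pow_dvd_pow _ h4).trans ?_
  rw [pow_add]
  exact mul_dvd_mul key dvd_rfl

lemma jtp_lim (a b : ℕ) (h : 0 < a + b) :
    Lim (fun m => X * (F a b m * f (a + b) ^ 2 - f (a + b) * S a b m)) 0 := by
  intro n
  refine ⟨n, fun m hm => ?_⟩
  rw [sub_zero]
  exact (pow_dvd_pow _ hm).trans (jtp_dvd a b h m)

noncomputable def D (m : ℕ) : Ser := ∏ i ∈ range m, (1 + X ^ (i + 1))

lemma D_P (k m : ℕ) : (∏ i ∈ range m, (1 + X ^ (k * (i + 1)))) * P k m = P (k * 2) m := by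
  simp only [P, ← prod_mul_distrib]
  refine prod_congr rfl fun i _ => ?_
  ring

lemma D_P1 (m : ℕ) : D m * P 1 m = P 2 m := by
  simpa [D] using D_P 1 m

lemma F10 (m : ℕ) : F 1 0 (m + 1) * (P 1 (m + 1) * P 1 m) = 2 * (P 2 (m + 1) * P 2 m) := by
  have : F 1 0 (m + 1) = D (m + 1) * (D m * 2) := by
    have e1 : ∏ i ∈ range (m + 1), ((1 : Ser) + X ^ (1 + (1 + 0) * i)) = D (m + 1) := by
      refine prod_congr rfl fun i _ => ?_
      rw [show 1 + (1 + 0) * i = i + 1 by ring]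
    have e2 : ∏ i ∈ range (m + 1), ((1 : Ser) + X ^ (0 + (1 + 0) * i)) = D m * 2 := by
      rw [prod_range_succ', D]
      have : ∀ i, 0 + (1 + 0) * (i + 1) = i + 1 := fun i => by ring
      simp only [this]
      rw [show 0 + (1 + 0) * 0 = 0 by norm_num, pow_zero, one_add_one_eq_two]
    rw [F, e1, e2]
  rw [this, ← D_P1, ← D_P1]; ring

lemma F12 (m : ℕ) : F 1 2 m * (P 6 m * P 1 (3 * m)) = P 2 (3 * m) * P 3 m := by
  have h : F 1 2 m * (∏ i ∈ range m, (1 + X ^ (3 * (i + 1)))) = D (3 * m) := by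
    induction m with
    | zero => simp [F, D]
    | succ m ih =>
      have e : 3 * (m + 1) = 3 * m + 1 + 1 + 1 := by ring
      unfold F D at ih ⊢
      rw [e]
      simp only [prod_range_succ]
      rw [← ih]
      ring
  have h2 := D_P 3 m
  rw [← D_P1, ← h, ← h2]
  ring

lemma theta10 : theta 1 0 * f 1 = 2 * f 2 ^ 2 := by
  have h := (jtp_lim 1 0 (by norm_num)).comp (φ := fun m => m + 1) (fun m => by omega)
  have p1 := Lim_f 1 one_pos
  have p2 := Lim_f 2 two_pos
  have p1' := p1.comp (φ := fun m => m + 1) (fun m => by omega)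
  have p2' := p2.comp (φ := fun m => m + 1) (fun m => by omega)
  have hS := (Lim_theta 1 0 (by norm_num)).comp (φ := fun m => m + 1) (fun m => by omega)
  have h1 := h.mul (p1'.mul p1)
  have h2 := (Lim.const X).mul
    ((((Lim.const 2).mul (p2'.mul p2)).mul (Lim.const (f 1 ^ 2))).add
    (((Lim.const (f 1)).mul (hS.mul (p1'.mul p1))).neg))
  have e : (fun m => X * (F 1 0 (m + 1) * f (1 + 0) ^ 2 - f (1 + 0) * S 1 0 (m + 1)) *
      (P 1 (m + 1) * P 1 m)) = (fun m => X * (2 * (P 2 (m + 1) * P 2 m) * f 1 ^ 2 +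
        -(f 1 * (S 1 0 (m + 1) * (P 1 (m + 1) * P 1 m))))) := by
    funext m
    rw [← F10]; ring
  rw [e] at h1
  have h3 := h1.unique h2
  rw [zero_mul] at h3
  have hne := f_ne 1 one_pos
  have h4 : (X : Ser) * f 1 ^ 2 ≠ 0 := mul_ne_zero X_ne_zero (pow_ne_zero _ hne)
  apply mul_left_cancel₀ h4
  linear_combination h3

lemma theta12 : theta 1 2 * (f 6 * f 1) = f 2 * f 3 ^ 2 := by
  have h := jtp_lim 1 2 (by norm_num)
  have p1 := (Lim_f 1 one_pos).comp (φ := fun m => 3 * m) (fun m => by omega)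
  have p2 := (Lim_f 2 two_pos).comp (φ := fun m => 3 * m) (fun m => by omega)
  have p3 := Lim_f 3 (by norm_num)
  have p6 := Lim_f 6 (by norm_num)
  have hS := Lim_theta 1 2 (by norm_num)
  have h1 := h.mul (p6.mul p1)
  have h2 := (Lim.const X).mul
    (((p2.mul p3).mul (Lim.const (f 3 ^ 2))).add
    (((Lim.const (f 3)).mul (hS.mul (p6.mul p1))).neg))
  have e : (fun m => X * (F 1 2 m * f (1 + 2) ^ 2 - f (1 + 2) * S 1 2 m) *
      (P 6 m * P 1 (3 * m))) = (fun m => X * (P 2 (3 * m) * P 3 m * f 3 ^ 2 +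
        -(f 3 * (S 1 2 m * (P 6 m * P 1 (3 * m)))))) := by
    funext m
    rw [← F12]; ring
  rw [e] at h1
  have h3 := h1.unique h2
  rw [zero_mul] at h3
  have hne := f_ne 3 (by norm_num)
  have h4 : (X : Ser) * f 3 ≠ 0 := mul_ne_zero X_ne_zero hne
  apply mul_left_cancel₀ h4
  linear_combination h3

lemma S_dissect (m : ℕ) : S 1 0 (3 * m + 1) = 2 * S 1 2 m ^ 3 + X * S 1 0 m ^ 9 := by
  induction m with
  | zero =>
    have e1 : E 1 0 0 = 0 := by decide
    have e2 : E 1 0 1 = 1 := by decide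
    have e3 : E 1 0 (-1) = 0 := by decide
    have e4 : E 1 2 0 = 0 := by decide
    simp [S, e1, e2, e3, e4]
    ring
  | succ m ih =>
    have e : 3 * (m + 1) + 1 = 3 * m + 1 + 1 + 1 + 1 := by ring
    have c9 : ∀ x : Ser, x ^ 9 = (x ^ 3) ^ 3 := fun x => by ring
    rw [e, S_succ, S_succ, S_succ, ih, S_succ 1 2 m, S_succ 1 0 m]
    simp only [c9, add_pow_char]
    have a1 := E_cast 1 2 ((m : ℤ) + 1)
    have a2 := E_cast 1 2 (-((m : ℤ) + 1))
    have a3 := E_cast 1 0 ((m : ℤ) + 1)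
    have a4 := E_cast 1 0 (-((m : ℤ) + 1))
    have b1 := E_cast 1 0 (((3 * m + 1 : ℕ) : ℤ) + 1)
    have b2 := E_cast 1 0 (-(((3 * m + 1 : ℕ) : ℤ) + 1))
    have b3 := E_cast 1 0 (((3 * m + 1 + 1 : ℕ) : ℤ) + 1)
    have b4 := E_cast 1 0 (-(((3 * m + 1 + 1 : ℕ) : ℤ) + 1))
    have b5 := E_cast 1 0 (((3 * m + 1 + 1 + 1 : ℕ) : ℤ) + 1)
    have b6 := E_cast 1 0 (-(((3 * m + 1 + 1 + 1 : ℕ) : ℤ) + 1))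
    generalize E 1 2 ((m : ℤ) + 1) = A1 at *
    generalize E 1 2 (-((m : ℤ) + 1)) = A2 at *
    generalize E 1 0 ((m : ℤ) + 1) = A3 at *
    generalize E 1 0 (-((m : ℤ) + 1)) = A4 at *
    generalize E 1 0 (((3 * m + 1 : ℕ) : ℤ) + 1) = B1 at *
    generalize E 1 0 (-(((3 * m + 1 : ℕ) : ℤ) + 1)) = B2 at *
    generalize E 1 0 (((3 * m + 1 + 1 : ℕ) : ℤ) + 1) = B3 at *
    generalize E 1 0 (-(((3 * m + 1 + 1 : ℕ) : ℤ) + 1)) = B4 at *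
    generalize E 1 0 (((3 * m + 1 + 1 + 1 : ℕ) : ℤ) + 1) = B5 at *
    generalize E 1 0 (-(((3 * m + 1 + 1 + 1 : ℕ) : ℤ) + 1)) = B6 at *
    push_cast at a1 a2 a3 a4 b1 b2 b3 b4 b5 b6
    have r1 : B1 = 3 * A1 := by
      have : 2 * (B1 : ℤ) = 2 * (3 * A1) := by linear_combination b1 - 3 * a1
      omega
    have r2 : B2 = 1 + 9 * A4 := by
      have : 2 * (B2 : ℤ) = 2 * (1 + 9 * A4) := by linear_combination b2 - 9 * a4
      omega
    have r3 : B3 = 3 * A2 := by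
      have : 2 * (B3 : ℤ) = 2 * (3 * A2) := by linear_combination b3 - 3 * a2
      omega
    have r4 : B4 = 3 * A1 := by
      have : 2 * (B4 : ℤ) = 2 * (3 * A1) := by linear_combination b4 - 3 * a1
      omega
    have r5 : B5 = 1 + 9 * A3 := by
      have : 2 * (B5 : ℤ) = 2 * (1 + 9 * A3) := by linear_combination b5 - 9 * a3
      omega
    have r6 : B6 = 3 * A2 := by
      have : 2 * (B6 : ℤ) = 2 * (3 * A2) := by linear_combination b6 - 3 * a2
      omega
    rw [r1, r2, r3, r4, r5, r6]
    ring

lemma theta_dissect : theta 1 0 = 2 * theta 1 2 ^ 3 + X * theta 1 0 ^ 9 := by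
  have h1 := (Lim_theta 1 0 (by norm_num)).comp (φ := fun m => 3 * m + 1) (fun m => by omega)
  have h2 := ((Lim.const 2).mul ((Lim_theta 1 2 (by norm_num)).pow 3)).add
    ((Lim.const X).mul ((Lim_theta 1 0 (by norm_num)).pow 9))
  simp only [S_dissect] at h1
  exact h1.unique h2

/-! ### Frobenius -/

lemma cube_eq (p : Ser) : p ^ 3 = PowerSeries.expand 3 (by norm_num) p := by
  have h := MvPowerSeries.map_frobenius_expand (σ := Unit) (R := ZMod 3) 3 (by norm_num) (f := p)
  rw [ZMod.frobenius_zmod] at h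
  have h2 := (PowerSeries.map_id (R := ZMod 3))
  rw [← h]
  exact congrArg (fun φ => φ (PowerSeries.expand 3 (by norm_num) p)) h2

lemma coeff_cube (p : Ser) (n : ℕ) : coeff n (p ^ 3) = if 3 ∣ n then coeff (n / 3) p else 0 := by
  rw [cube_eq, coeff_expand]

lemma coeff_dis0 (p q r : Ser) (n : ℕ) :
    coeff (3 * n) (p ^ 3 + X * q ^ 3 + X ^ 2 * r ^ 3) = coeff n p := by
  rw [map_add, map_add, coeff_cube, if_pos (by omega), Nat.mul_div_cancel_left _ (by norm_num)]
  have h1 : coeff (3 * n) (X * q ^ 3) = 0 := by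
    rcases n with _ | n
    · simp
    · rw [show 3 * (n + 1) = 3 * n + 2 + 1 by ring, coeff_succ_X_mul, coeff_cube,
        if_neg (by omega)]
  have h2 : coeff (3 * n) (X ^ 2 * r ^ 3) = 0 := by
    rcases n with _ | n
    · simp
    · rw [show 3 * (n + 1) = 3 * n + 1 + 2 by ring, coeff_X_pow_mul, coeff_cube,
        if_neg (by omega)]
  rw [h1, h2]; simp

lemma coeff_dis1 (p q r : Ser) (n : ℕ) :
    coeff (3 * n + 1) (p ^ 3 + X * q ^ 3 + X ^ 2 * r ^ 3) = coeff n q := by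
  rw [map_add, map_add, coeff_cube, if_neg (by omega), coeff_succ_X_mul, coeff_cube,
    if_pos (by omega), Nat.mul_div_cancel_left _ (by norm_num)]
  have h2 : coeff (3 * n + 1) (X ^ 2 * r ^ 3) = 0 := by
    rcases n with _ | n
    · rw [coeff_X_pow_mul']; simp
    · rw [show 3 * (n + 1) + 1 = 3 * n + 2 + 2 by ring, coeff_X_pow_mul, coeff_cube,
        if_neg (by omega)]
  rw [h2]; simp

lemma main_series (G : Ser) (hG : G * f 1 ^ 5 = f 2 ^ 4) (n : ℕ) :
    coeff (27 * n + 10) G = coeff (3 * n + 1) G := by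
  have ht := theta10
  have hA := theta12
  have hd := theta_dissect
  have e6 : f 6 = f 2 ^ 3 := f_three 2 two_pos
  have e3 : f 3 = f 1 ^ 3 := f_three 1 one_pos
  rw [e6, e3] at hA
  generalize theta 1 2 = A at *
  generalize theta 1 0 = t at *
  obtain ⟨ψ, hψ⟩ : ∃ ψ, t = -ψ := ⟨-t, by ring⟩
  subst hψ
  have h3 := three_zero
  have hu : (f 1)⁻¹ * f 1 = 1 := PowerSeries.inv_mul_cancel _ (by
    rw [coeff_zero_f 1 one_pos]; exact one_ne_zero)
  have hv : (f 2)⁻¹ * f 2 = 1 := PowerSeries.inv_mul_cancel _ (by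
    rw [coeff_zero_f 2 two_pos]; exact one_ne_zero)
  generalize (f 1)⁻¹ = u at *
  generalize (f 2)⁻¹ = v at *
  generalize f 1 = x at *
  generalize f 2 = y at *
  have hd' : ψ = A ^ 3 + X * ψ ^ 9 := by linear_combination -hd - A ^ 3 * h3
  have hψ : ψ = y ^ 2 * u := by
    calc ψ = ψ * (u * x) := by rw [hu, mul_one]
      _ = y ^ 2 * u := by linear_combination - u * ht - u * y ^ 2 * h3
  have hA' : A = x ^ 5 * v ^ 2 := by
    calc A = A * (v * y) ^ 3 * (u * x) := by rw [hu, hv]; ring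
      _ = v ^ 3 * u * (A * (y ^ 3 * x)) := by ring
      _ = x ^ 5 * v ^ 2 * (u * x) * (v * y) := by rw [hA]; ring
      _ = _ := by rw [hu, hv]; ring
  have K0 : G = u ^ 3 * ψ ^ 2 := by
    calc G = G * (u * x) ^ 5 := by rw [hu]; ring
      _ = u ^ 5 * (G * x ^ 5) := by ring
      _ = u ^ 3 * ψ ^ 2 := by rw [hG, hψ]; ring
  have K1 : u ^ 3 * A ^ 3 * ψ ^ 9 = x ^ 3 * y ^ 12 := by
    calc u ^ 3 * A ^ 3 * ψ ^ 9 = x ^ 3 * y ^ 12 * (u * x) ^ 12 * (v * y) ^ 6 := by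
          rw [hψ, hA']; ring
      _ = _ := by rw [hu, hv]; ring
  have K2 : 2 * x * y ^ 4 = 2 * x ^ 3 * ψ ^ 2 := by
    calc 2 * x * y ^ 4 = 2 * x * y ^ 4 * (u * x) ^ 2 := by rw [hu]; ring
      _ = _ := by rw [hψ]; ring
  have K3 : x * A ^ 2 = x ^ 12 * v ^ 6 * ψ := by
    calc x * A ^ 2 = x ^ 11 * v ^ 4 * (u * x) * (v * y) ^ 2 := by rw [hu, hv, hA']; ring
      _ = _ := by rw [hψ]; ring
  have K4 : x ^ 12 * v ^ 6 * ψ ^ 9 = x ^ 3 * y ^ 12 := by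
    calc x ^ 12 * v ^ 6 * ψ ^ 9 = x ^ 3 * y ^ 12 * (u * x) ^ 9 * (v * y) ^ 6 := by rw [hψ]; ring
      _ = _ := by rw [hu, hv]; ring
  clear hψ hA' hG ht hA hd hu hv e6 e3
  have C1 : G = (u * A ^ 2) ^ 3 + X * (2 * x * y ^ 4) ^ 3 + X ^ 2 * (u * ψ ^ 6) ^ 3 := by
    linear_combination K0 + u ^ 3 * (ψ + A ^ 3 + X * ψ ^ 9) * hd' + 2 * X * K1
      - 2 * X * x ^ 3 * y ^ 12 * h3
  have C2 : 2 * x * y ^ 4 = (2 * (x * A ^ 2)) ^ 3 + X * (x * A * ψ ^ 3) ^ 3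
      + X ^ 2 * (2 * x * ψ ^ 6) ^ 3 := by
    linear_combination K2 + 2 * x ^ 3 * (ψ + A ^ 3 + X * ψ ^ 9) * hd'
      + (-2 * x ^ 3 * A ^ 6 + X * x ^ 3 * A ^ 3 * ψ ^ 9 - 2 * X ^ 2 * x ^ 3 * ψ ^ 18) * h3
  have C3 : 2 * (x * A ^ 2) = (2 * x ^ 4 * v ^ 2 * A) ^ 3 + X * (2 * x * y ^ 4) ^ 3
      + X ^ 2 * 0 ^ 3 := by
    linear_combination 2 * K3 + 2 * x ^ 12 * v ^ 6 * hd' + 2 * X * K4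
      + (-2 * x ^ 12 * v ^ 6 * A ^ 3 - 2 * X * x ^ 3 * y ^ 12) * h3
  have L1 : ∀ n, coeff (3 * n + 1) G = coeff n (2 * x * y ^ 4) := by
    intro n; rw [C1, coeff_dis1]
  have L2 : ∀ n, coeff (3 * n) (2 * x * y ^ 4) = coeff n (2 * (x * A ^ 2)) := by
    intro n
    conv_lhs => rw [C2]
    rw [coeff_dis0]
  have L3 : ∀ n, coeff (3 * n + 1) (2 * (x * A ^ 2)) = coeff n (2 * x * y ^ 4) := by
    intro n
    conv_lhs => rw [C3]
    rw [coeff_dis1]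
  rw [L1, show 27 * n + 10 = 3 * (3 * (3 * n + 1)) + 1 by ring, L1, L2, L3]

/-! ### Counting -/

def MS (s : Finset (ℕ × ℕ)) (n : ℕ) : Set (Multiset (ℕ × ℕ)) :=
  {μ | (∀ p ∈ μ, p ∈ s) ∧ (μ.map Prod.fst).sum = n}

lemma MS_empty (n : ℕ) : MS ∅ n = if n = 0 then {0} else ∅ := by
  ext μ
  have : (∀ p ∈ μ, p ∈ (∅ : Finset (ℕ × ℕ))) ↔ μ = 0 := by
    simp [Multiset.eq_zero_iff_forall_notMem]
  simp only [MS, Set.mem_ofPred_eq, this]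
  split_ifs with h
  · subst h
    simp only [Set.mem_singleton_iff, and_iff_left_iff_imp]
    rintro rfl; simp
  · simp only [Set.mem_empty_iff_false, iff_false, not_and]
    rintro rfl; simpa using (Ne.symm h)

lemma MS_insert_lt (i : ℕ × ℕ) (s : Finset (ℕ × ℕ)) (n : ℕ) (hn : n < i.1) :
    MS (insert i s) n = MS s n := by
  ext μ
  simp only [MS, Set.mem_ofPred_eq]
  refine ⟨fun ⟨h1, h2⟩ => ⟨fun p hp => ?_, h2⟩,
    fun ⟨h1, h2⟩ => ⟨fun p hp => mem_insert_of_mem (h1 p hp), h2⟩⟩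
  rcases mem_insert.1 (h1 p hp) with rfl | h
  · have := Multiset.single_le_sum (fun x _ => Nat.zero_le x) _ (Multiset.mem_map_of_mem Prod.fst hp)
    omega
  · exact h

lemma MS_insert_ge (i : ℕ × ℕ) (s : Finset (ℕ × ℕ)) (n : ℕ) :
    MS (insert i s) (n + i.1) = MS s (n + i.1) ∪ (fun μ => i ::ₘ μ) '' MS (insert i s) n := by
  ext μ
  simp only [MS, Set.mem_ofPred_eq, Set.mem_union, Set.mem_image]
  constructor
  · rintro ⟨h1, h2⟩
    by_cases hi : i ∈ μ
    · right
      obtain ⟨ν, rfl⟩ := Multiset.exists_cons_of_mem hi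
      refine ⟨ν, ⟨fun p hp => h1 p (Multiset.mem_cons_of_mem hp), ?_⟩, rfl⟩
      simp at h2; omega
    · left
      refine ⟨fun p hp => ?_, h2⟩
      rcases mem_insert.1 (h1 p hp) with rfl | h
      · exact absurd hp hi
      · exact h
  · rintro (⟨h1, h2⟩ | ⟨ν, ⟨h1, h2⟩, rfl⟩)
    · exact ⟨fun p hp => mem_insert_of_mem (h1 p hp), h2⟩
    · refine ⟨fun p hp => ?_, ?_⟩
      · rcases Multiset.mem_cons.1 hp with rfl | hp
        · exact mem_insert_self _ _
        · exact h1 p hp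
      · simp [h2]; omega

lemma MS_finite (s : Finset (ℕ × ℕ)) (hs : ∀ p ∈ s, 0 < p.1) : ∀ n, (MS s n).Finite := by
  induction s using Finset.induction_on with
  | empty => intro n; rw [MS_empty]; split_ifs <;> simp
  | insert i s hi ih =>
    have ih := ih (fun p hp => hs p (mem_insert_of_mem hp))
    have h0 := hs i (mem_insert_self _ _)
    intro n
    induction n using Nat.strong_induction_on with
    | _ n IH =>
      rcases lt_or_ge n i.1 with h | h
      · rw [MS_insert_lt _ _ _ h]; exact ih n
      · obtain ⟨k, rfl⟩ := Nat.exists_eq_add_of_le' h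
        rw [MS_insert_ge]
        exact (ih _).union ((IH k (by omega)).image _)

noncomputable def GS (s : Finset (ℕ × ℕ)) : Ser := PowerSeries.mk fun n => ((MS s n).ncard : ZMod 3)

lemma GS_insert (i : ℕ × ℕ) (s : Finset (ℕ × ℕ)) (hi : i ∉ s)
    (hs : ∀ p ∈ insert i s, 0 < p.1) : GS (insert i s) * (1 - X ^ i.1) = GS s := by
  rw [mul_sub, mul_one]
  ext n
  rw [map_sub, coeff_mul_X_pow']
  simp only [GS, coeff_mk]
  split_ifs with h
  · obtain ⟨k, rfl⟩ := Nat.exists_eq_add_of_le' h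
    have hdis : Disjoint (MS s (k + i.1)) ((fun μ => i ::ₘ μ) '' MS (insert i s) k) := by
      rw [Set.disjoint_left]
      rintro _ ⟨h1, _⟩ ⟨ν, _, rfl⟩
      exact hi (h1 i (Multiset.mem_cons_self _ _))
    have hinj : Function.Injective (fun μ : Multiset (ℕ × ℕ) => i ::ₘ μ) :=
      fun μ ν h => (Multiset.cons_inj_right i).1 h
    rw [Nat.add_sub_cancel, MS_insert_ge, Set.ncard_union_eq hdis
      (MS_finite s (fun p hp => hs p (mem_insert_of_mem hp)) _) ((MS_finite _ hs _).image _),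
      Set.ncard_image_of_injective _ hinj]
    push_cast; ring
  · rw [MS_insert_lt _ _ _ (by omega), sub_zero]

lemma GS_prod (s : Finset (ℕ × ℕ)) (hs : ∀ p ∈ s, 0 < p.1) :
    GS s * ∏ p ∈ s, (1 - X ^ p.1) = 1 := by
  induction s using Finset.induction_on with
  | empty =>
    simp only [prod_empty, mul_one]
    ext n
    rw [GS, coeff_mk, MS_empty, coeff_one]
    split_ifs <;> simp
  | insert i s hi ih =>
    rw [prod_insert hi, ← mul_assoc, GS_insert i s hi hs]
    exact ih (fun p hp => hs p (mem_insert_of_mem hp))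

def parts (M : ℕ) : Finset (ℕ × ℕ) :=
  (range (2 * M) ×ˢ Icc 1 5).filter (fun p => 0 < p.1 ∧ (Even p.1 → p.2 = 1))

lemma parts_prod (M : ℕ) : (∏ p ∈ parts (M + 1), ((1 : Ser) - X ^ p.1)) * P 2 M ^ 4 =
    P 1 (2 * M + 1) ^ 5 := by
  have h : ∏ p ∈ parts (M + 1), ((1 : Ser) - X ^ p.1) =
      ∏ m ∈ range (2 * M + 2), if 0 < m then (1 - X ^ m) ^ (if Even m then 1 else 5) else 1 := by
    rw [parts, prod_filter, prod_product]
    refine prod_congr rfl fun m _ => ?_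
    have : Icc 1 5 = ({1, 2, 3, 4, 5} : Finset ℕ) := by decide
    rw [this]
    by_cases h0 : 0 < m <;> by_cases h1 : Even m <;> simp [h0, h1]
  rw [h, prod_range_succ']
  simp only [Nat.succ_pos', if_true, lt_irrefl, if_false, mul_one]
  clear h
  induction M with
  | zero => simp [P]
  | succ M ih =>
    rw [show 2 * (M + 1) + 1 = 2 * M + 1 + 1 + 1 by ring, prod_range_succ, prod_range_succ,
      P_succ, P_succ, P_succ]
    have o1 : Even (2 * M + 1 + 1) := ⟨M + 1, by ring⟩
    have o2 : ¬ Even (2 * M + 1 + 1 + 1) := by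
      rw [Nat.not_even_iff_odd]; exact ⟨M + 1, by ring⟩
    rw [if_pos o1, if_neg o2, one_mul, one_mul, show 2 * (M + 1) = 2 * M + 1 + 1 by ring]
    simp only [mul_pow]
    rw [← ih]
    ring

lemma a_eq (M n : ℕ) (h : n < 2 * M) : a 5 n = (MS (parts M) n).ncard := by
  rw [a, Nat.card_coe_set_eq]
  congr 1
  ext μ
  simp only [coloredOddPartitions, MS, Set.mem_ofPred_eq, parts, mem_filter, mem_product, mem_range,
    mem_Icc]
  constructor
  · rintro ⟨h1, h2⟩
    refine ⟨fun p hp => ?_, h2⟩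
    have := Multiset.single_le_sum (fun x _ => Nat.zero_le x) _ (Multiset.mem_map_of_mem Prod.fst hp)
    obtain ⟨q1, q2, q3, q4⟩ := h1 p hp
    exact ⟨⟨by omega, q2, q3⟩, q1, q4⟩
  · rintro ⟨h1, h2⟩
    refine ⟨fun p hp => ?_, h2⟩
    obtain ⟨⟨_, q2, q3⟩, q1, q4⟩ := h1 p hp
    exact ⟨q1, q2, q3, q4⟩

noncomputable def G : Ser := PowerSeries.mk fun n => (a 5 n : ZMod 3)

lemma G_lim : Lim (fun M => GS (parts (M + 1))) G := by
  intro n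
  refine ⟨n, fun m hm => ?_⟩
  rw [X_pow_dvd_iff]
  intro k hk
  simp only [map_sub, G, GS, coeff_mk, a_eq (m + 1) k (by omega), sub_self]

lemma G_eq : G * f 1 ^ 5 = f 2 ^ 4 := by
  have h1 := G_lim.mul (((Lim_f 1 one_pos).comp (φ := fun m => 2 * m + 1) (fun m => by omega)).pow 5)
  have h2 := (Lim_f 2 two_pos).pow 4
  refine Lim.unique ?_ h2
  convert h1 using 2 with M
  rw [← parts_prod, ← mul_assoc, GS_prod, one_mul]
  intro p hp
  exact (mem_filter.1 hp).2.1

end S10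

theorem stmt10 (n : ℕ) : a 5 (27 * n + 10) ≡ a 5 (3 * n + 1) [MOD 3] := by
  have h := S10.main_series S10.G S10.G_eq n
  simp only [S10.G, PowerSeries.coeff_mk] at h
  exact (ZMod.natCast_eq_natCast_iff _ _ _).1 h
end

section
/- For all integers n ≥ 0, a_5(81n + 10) ≡ a_5(9n + 1) (mod 3). -/
theorem shanks_psi_aux {R : Type*} [CommRing R] (x : R) (v u : ℕ → R)
    (hv : ∀ s, v s * (1 - x ^ (2 * s + 1)) = 1)
    (hu : ∀ s, u s = (1 - x ^ (2 * s + 2)) * v s) (n m : ℕ) (hm : m ≤ n) :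
    ∑ s ∈ Finset.range (m + 1), ((∏ j ∈ Finset.Ico s (n + 1), u j) * x ^ (s * (2 * n + 3))
      - (∏ j ∈ Finset.Ico s n, u j) * x ^ (s * (2 * n + 1)))
    = (∏ j ∈ Finset.Ico m n, u j) * x ^ ((m + 1) * (2 * n + 1)) * (1 - x ^ (2 * m + 1)) * v n := by
  induction m with
  | zero =>
    rw [Finset.sum_range_one, Finset.prod_Ico_succ_top (Nat.zero_le n)]
    rw [hu n]
    generalize (∏ j ∈ Finset.Ico 0 n, u j) = P
    have := hv n
    simp only [zero_mul, pow_zero]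
    ring_nf at this ⊢
    linear_combination P * this
  | succ m ih =>
    rw [Finset.sum_range_succ, ih (by omega)]
    rw [Finset.prod_Ico_succ_top (by omega : m + 1 ≤ n)]
    rw [Finset.prod_eq_prod_Ico_succ_bot (by omega : m < n)]
    rw [hu n, hu m]
    generalize (∏ j ∈ Finset.Ico (m + 1) n, u j) = P
    have h1 := hv n
    have h2 := hv m
    obtain ⟨y, hy⟩ : ∃ y, y = x ^ m := ⟨_, rfl⟩
    obtain ⟨z, hz⟩ : ∃ y, y = x ^ n := ⟨_, rfl⟩
    obtain ⟨t, ht⟩ : ∃ y, y = x ^ (m * n) := ⟨_, rfl⟩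
    have e1 : x ^ ((m + 1) * (2 * n + 1)) = t ^ 2 * y * z ^ 2 * x := by subst hy hz ht; ring
    have e2 : x ^ ((m + 1) * (2 * n + 3)) = t ^ 2 * y ^ 3 * z ^ 2 * x ^ 3 := by subst hy hz ht; ring
    have e3 : x ^ ((m + 1 + 1) * (2 * n + 1)) = t ^ 2 * y * z ^ 4 * x ^ 2 := by
      subst hy hz ht; ring
    have e4 : x ^ (2 * m + 1) = y ^ 2 * x := by subst hy; ring
    have e5 : x ^ (2 * n + 1) = z ^ 2 * x := by subst hz; ring
    have e6 : x ^ (2 * m + 2) = y ^ 2 * x ^ 2 := by subst hy; ring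
    have e7 : x ^ (2 * n + 2) = z ^ 2 * x ^ 2 := by subst hz; ring
    have e8 : x ^ (2 * (m + 1) + 1) = y ^ 2 * x ^ 3 := by subst hy; ring
    rw [e4] at h2
    rw [e5] at h1
    rw [e1, e2, e3, e4, e6, e7, e8]
    linear_combination ((1 - y ^ 2 * x ^ 2) * P * t ^ 2 * y * z ^ 2 * x * v n) * h2
      + (P * t ^ 2 * y * z ^ 2 * x) * h1

theorem shanks_psi {R : Type*} [CommRing R] (x : R) (v u : ℕ → R)
    (hv : ∀ s, v s * (1 - x ^ (2 * s + 1)) = 1)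
    (hu : ∀ s, u s = (1 - x ^ (2 * s + 2)) * v s) (n : ℕ) :
    ∑ s ∈ Finset.range n, (∏ j ∈ Finset.Ico s n, u j) * x ^ (s * (2 * n + 1))
    = ∑ s ∈ Finset.range (2 * n), x ^ (s * (s + 1) / 2) := by
  induction n with
  | zero => simp
  | succ n ih =>
    have h := shanks_psi_aux x v u hv hu n n le_rfl
    rw [Finset.sum_sub_distrib, Finset.sum_range_succ (fun s => (∏ j ∈ Finset.Ico s n, u j) * x ^ (s * (2 * n + 1))), ih] at h
    rw [show 2 * (n + 1) = 2 * n + 1 + 1 by ring, Finset.sum_range_succ _ (2 * n + 1),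
      Finset.sum_range_succ _ (2 * n)]
    have e1 : 2 * n * (2 * n + 1) / 2 = n * (2 * n + 1) := by
      rw [mul_assoc]; exact Nat.mul_div_cancel_left _ (by norm_num)
    have e2 : (2 * n + 1) * (2 * n + 1 + 1) / 2 = (n + 1) * (2 * n + 1) := by
      rw [show (2 * n + 1) * (2 * n + 1 + 1) = 2 * ((n + 1) * (2 * n + 1)) by ring]
      exact Nat.mul_div_cancel_left _ (by norm_num)
    rw [e1, e2]
    simp only [Finset.Ico_self, Finset.prod_empty, one_mul] at h
    linear_combination h + x ^ ((n + 1) * (2 * n + 1)) * hv n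

theorem shanks_psi_dvd {R : Type*} [CommRing R] (x : R) (v u : ℕ → R)
    (hv : ∀ s, v s * (1 - x ^ (2 * s + 1)) = 1)
    (hu : ∀ s, u s = (1 - x ^ (2 * s + 2)) * v s) (n : ℕ) (hn : 0 < n) :
    x ^ (2 * n + 1) ∣ ∑ s ∈ Finset.range (2 * n), x ^ (s * (s + 1) / 2)
      - ∏ j ∈ Finset.range n, u j := by
  rw [← shanks_psi x v u hv hu n]
  obtain ⟨k, rfl⟩ : ∃ k, n = k + 1 := ⟨n - 1, by omega⟩
  rw [Finset.sum_range_succ']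
  simp only [zero_mul, pow_zero, mul_one, Finset.range_eq_Ico, add_sub_cancel_right]
  refine Finset.dvd_sum fun s _ => Dvd.dvd.mul_left (pow_dvd_pow _ ?_) _
  nlinarith

theorem shanks_phi_aux {R : Type*} [CommRing R] (x : R) (v u w : ℕ → R)
    (hv : ∀ s, v s * (1 + x ^ (s + 1)) = 1)
    (hw : ∀ s, w (s + 1) = 2 * v s) (hw0 : w 0 = 1)
    (hu : ∀ s, u s = (1 - x ^ (s + 1)) * v s) (n m : ℕ) (hm : m ≤ n) :
    ∑ s ∈ Finset.range (m + 1),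
      (w s * (-1) ^ s * (∏ j ∈ Finset.Ico s (n + 1), u j) * x ^ (s * (n + 2))
      - w s * (-1) ^ s * (∏ j ∈ Finset.Ico s n, u j) * x ^ (s * (n + 1)))
    = - 2 * (-1) ^ m * (∏ j ∈ Finset.Ico m n, u j) * x ^ ((m + 1) * (n + 1)) * v n := by
  induction m with
  | zero =>
    rw [Finset.sum_range_one, Finset.prod_Ico_succ_top (Nat.zero_le n)]
    rw [hu n, hw0]
    generalize (∏ j ∈ Finset.Ico 0 n, u j) = P
    have := hv n
    simp only [zero_mul, pow_zero]
    ring_nf at this ⊢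
    linear_combination (P) * this
  | succ m ih =>
    rw [Finset.sum_range_succ, ih (by omega)]
    rw [Finset.prod_Ico_succ_top (by omega : m + 1 ≤ n)]
    rw [Finset.prod_eq_prod_Ico_succ_bot (by omega : m < n)]
    rw [hu n, hu m, hw m]
    generalize (∏ j ∈ Finset.Ico (m + 1) n, u j) = P
    have h1 := hv n
    have h2 := hv m
    obtain ⟨y, hy⟩ : ∃ y, y = x ^ m := ⟨_, rfl⟩
    obtain ⟨z, hz⟩ : ∃ y, y = x ^ n := ⟨_, rfl⟩
    obtain ⟨t, ht⟩ : ∃ y, y = x ^ (m * n) := ⟨_, rfl⟩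
    have e1 : x ^ ((m + 1) * (n + 1)) = t * y * z * x := by subst hy hz ht; ring
    have e2 : x ^ ((m + 1) * (n + 2)) = t * y ^ 2 * z * x ^ 2 := by subst hy hz ht; ring
    have e3 : x ^ ((m + 1 + 1) * (n + 1)) = t * y * z ^ 2 * x ^ 2 := by
      subst hy hz ht; ring
    have e4 : x ^ (m + 1) = y * x := by subst hy; ring
    have e5 : x ^ (n + 1) = z * x := by subst hz; ring
    rw [e4] at h2
    rw [e5] at h1
    rw [e1, e2, e3, e4, e5, pow_succ (-1 : R) m]
    generalize (-1 : R) ^ m = ε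
    linear_combination (-2 * ε * P * t * y * z * x * v m) * h1
      + (2 * ε * P * t * y * z ^ 2 * x ^ 2 * v n) * h2

theorem shanks_phi {R : Type*} [CommRing R] (x : R) (v u w : ℕ → R)
    (hv : ∀ s, v s * (1 + x ^ (s + 1)) = 1)
    (hw : ∀ s, w (s + 1) = 2 * v s) (hw0 : w 0 = 1)
    (hu : ∀ s, u s = (1 - x ^ (s + 1)) * v s) (n : ℕ) :
    ∑ s ∈ Finset.range (n + 1), w s * (-1) ^ s * (∏ j ∈ Finset.Ico s n, u j) * x ^ (s * (n + 1))
    = 1 + ∑ s ∈ Finset.range n, 2 * (-1) ^ (s + 1) * x ^ ((s + 1) ^ 2) := by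
  induction n with
  | zero => simp [hw0]
  | succ n ih =>
    have h := shanks_phi_aux x v u w hv hw hw0 hu n n le_rfl
    rw [Finset.sum_sub_distrib, ih] at h
    rw [Finset.sum_range_succ _ (n + 1), Finset.sum_range_succ _ n, Finset.sum_range_succ _ n]
    rw [Finset.sum_range_succ _ n] at h
    simp only [Finset.Ico_self, Finset.prod_empty, mul_one] at h ⊢
    have e1 : x ^ ((n + 1) * (n + 1 + 1)) = x ^ ((n + 1) ^ 2) * x ^ (n + 1) := by ring
    have e2 : x ^ ((n + 1) * (n + 1)) = x ^ ((n + 1) ^ 2) := by ring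
    rw [hw, e1]
    rw [e2] at h
    rw [pow_succ (-1 : R) n]
    have h1 := hv n
    linear_combination h - 2 * (-1) ^ n * x ^ ((n + 1) ^ 2) * h1

theorem shanks_phi_dvd {R : Type*} [CommRing R] (x : R) (v u : ℕ → R)
    (hv : ∀ s, v s * (1 + x ^ (s + 1)) = 1)
    (hu : ∀ s, u s = (1 - x ^ (s + 1)) * v s) (n : ℕ) :
    x ^ (n + 1) ∣ (1 + ∑ s ∈ Finset.range n, 2 * (-1) ^ (s + 1) * x ^ ((s + 1) ^ 2))
      - ∏ j ∈ Finset.range n, u j := by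
  rw [← shanks_phi x v u (fun s => Nat.casesOn s 1 (fun s => 2 * v s)) hv (fun _ => rfl) rfl hu n]
  rw [Finset.sum_range_succ']
  simp only [zero_mul, pow_zero, mul_one, Finset.range_eq_Ico]
  change _ ∣ _ + 1 * _ - _
  rw [one_mul, add_sub_cancel_right]
  refine Finset.dvd_sum fun s _ => Dvd.dvd.mul_left (pow_dvd_pow _ ?_) _
  nlinarith

/-- multisets supported on `S` with total weight `n` -/
def wset (S : Finset (ℕ × ℕ)) (n : ℕ) : Set (Multiset (ℕ × ℕ)) :=
  {s | (∀ p ∈ s, p ∈ S) ∧ (s.map Prod.fst).sum = n}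

theorem wset_insert_lt (S : Finset (ℕ × ℕ)) (i : ℕ × ℕ) (n : ℕ) (h : n < i.1) :
    wset (insert i S) n = wset S n := by
  ext s
  simp only [wset, Set.mem_ofPred_eq]
  refine and_congr_left fun hs => ⟨fun H p hp => ?_, fun H p hp => Finset.mem_insert_of_mem (H p hp)⟩
  rcases Finset.mem_insert.1 (H p hp) with rfl | h'
  · have := Multiset.single_le_sum (s := s.map Prod.fst) (fun _ _ => Nat.zero_le _) p.1
      (Multiset.mem_map_of_mem _ hp)
    omega
  · exact h'

theorem wset_insert_ge (S : Finset (ℕ × ℕ)) (i : ℕ × ℕ) (n : ℕ) :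
    wset (insert i S) (n + i.1) =
      wset S (n + i.1) ∪ (fun s => i ::ₘ s) '' wset (insert i S) n := by
  ext s
  simp only [wset, Set.mem_ofPred_eq, Set.mem_union, Set.mem_image]
  constructor
  · rintro ⟨h1, h2⟩
    by_cases hi : i ∈ s
    · right
      obtain ⟨t, rfl⟩ := Multiset.exists_cons_of_mem hi
      refine ⟨t, ⟨fun p hp => h1 p (Multiset.mem_cons_of_mem hp), ?_⟩, rfl⟩
      simp at h2
      omega
    · left
      refine ⟨fun p hp => ?_, h2⟩
      rcases Finset.mem_insert.1 (h1 p hp) with rfl | h'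
      · exact absurd hp hi
      · exact h'
  · rintro (⟨h1, h2⟩ | ⟨t, ⟨h1, h2⟩, rfl⟩)
    · exact ⟨fun p hp => Finset.mem_insert_of_mem (h1 p hp), h2⟩
    · refine ⟨fun p hp => ?_, ?_⟩
      · rcases Multiset.mem_cons.1 hp with rfl | h'
        · exact Finset.mem_insert_self _ _
        · exact h1 p h'
      · simp; omega

theorem wset_empty (n : ℕ) : wset ∅ n = if n = 0 then {0} else ∅ := by
  ext s
  simp only [wset, Set.mem_ofPred_eq, Finset.notMem_empty]
  constructor
  · rintro ⟨h1, h2⟩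
    have : s = 0 := Multiset.eq_zero_of_forall_notMem h1
    subst this
    simp at h2
    subst h2
    simp
  · split_ifs with h
    · intro hs
      have : s = 0 := hs
      subst this; subst h; simp
    · intro hs; exact absurd hs (Set.notMem_empty _)

theorem wset_finite (S : Finset (ℕ × ℕ)) (hS : ∀ p ∈ S, 0 < p.1) (n : ℕ) : (wset S n).Finite := by
  induction S using Finset.induction_on generalizing n with
  | empty => rw [wset_empty]; split_ifs <;> simp
  | insert i S hi ih =>
    have ih' := fun n => ih (fun p hp => hS p (Finset.mem_insert_of_mem hp)) n
    have hpos := hS i (Finset.mem_insert_self _ _)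
    induction n using Nat.strong_induction_on with
    | _ n IH =>
      by_cases h : n < i.1
      · rw [wset_insert_lt _ _ _ h]; exact ih' n
      · obtain ⟨k, rfl⟩ : ∃ k, n = k + i.1 := ⟨n - i.1, by omega⟩
        rw [wset_insert_ge]
        exact (ih' _).union ((IH k (by omega)).image _)

open PowerSeries in
theorem wset_genfun (R : Type*) [CommRing R] (S : Finset (ℕ × ℕ)) (hS : ∀ p ∈ S, 0 < p.1) :
    (PowerSeries.mk fun n => ((wset S n).ncard : R)) * ∏ p ∈ S, (1 - (X : R⟦X⟧) ^ p.1) = 1 := by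
  induction S using Finset.induction_on with
  | empty =>
    rw [Finset.prod_empty, mul_one]
    ext n
    rw [coeff_mk, wset_empty, coeff_one]
    split_ifs <;> simp
  | insert i S hi ih =>
    have hS' : ∀ p ∈ S, 0 < p.1 := fun p hp => hS p (Finset.mem_insert_of_mem hp)
    have ih' := ih hS'
    rw [Finset.prod_insert hi, ← mul_assoc]
    refine Eq.trans ?_ ih'
    congr 1
    ext n
    rw [mul_sub, mul_one, map_sub, coeff_mk, coeff_mk, coeff_mul_X_pow']
    by_cases h : n < i.1
    · rw [if_neg (by omega), wset_insert_lt _ _ _ h, sub_zero]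
    · obtain ⟨k, rfl⟩ : ∃ k, n = k + i.1 := ⟨n - i.1, by omega⟩
      rw [if_pos (by omega), coeff_mk, wset_insert_ge, Nat.add_sub_cancel,
        Set.ncard_union_eq ?_ (wset_finite S hS' _) ((wset_finite _ hS _).image _),
        Set.ncard_image_of_injective]
      · push_cast; ring
      · exact fun a b h => Multiset.cons_inj_right i |>.1 h
      · rw [Set.disjoint_left]
        rintro s ⟨h1, _⟩ ⟨t, _, rfl⟩
        exact hi (h1 i (Multiset.mem_cons_self _ _))

section alg
open PowerSeries

/-- The series of coefficients in the progression `3 n + r`. -/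
noncomputable def secU (r : ℕ) (f : (ZMod 3)⟦X⟧) : (ZMod 3)⟦X⟧ :=
  PowerSeries.mk fun n => coeff (3 * n + r) f

theorem cube_expand (f : (ZMod 3)⟦X⟧) : f ^ 3 = expand 3 (by norm_num) f := by
  have h := MvPowerSeries.map_frobenius_expand (R := ZMod 3) (σ := Unit) 3 (by norm_num) (f := f)
  rw [ZMod.frobenius_zmod, MvPowerSeries.map_id] at h
  exact h.symm

theorem coeff_cube0 (f : (ZMod 3)⟦X⟧) (n : ℕ) : coeff (3 * n) (f ^ 3) = coeff n f := by
  rw [cube_expand, coeff_expand_mul]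

theorem coeff_cube_ndvd (f : (ZMod 3)⟦X⟧) (n : ℕ) (h : ¬ 3 ∣ n) : coeff n (f ^ 3) = 0 := by
  rw [cube_expand, coeff_expand_of_not_dvd _ _ _ h]

theorem three_zero : (3 : (ZMod 3)⟦X⟧) = 0 := by
  have : (3 : (ZMod 3)⟦X⟧) = C (3 : ZMod 3) := (map_ofNat C 3).symm
  rw [this, show (3 : ZMod 3) = 0 from rfl, map_zero]

theorem coeff_comb (a b c : (ZMod 3)⟦X⟧) (n : ℕ) :
    coeff (3 * n) (a ^ 3 + X * b ^ 3 + X ^ 2 * c ^ 3) = coeff n a ∧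
    coeff (3 * n + 1) (a ^ 3 + X * b ^ 3 + X ^ 2 * c ^ 3) = coeff n b ∧
    coeff (3 * n + 2) (a ^ 3 + X * b ^ 3 + X ^ 2 * c ^ 3) = coeff n c := by
  refine ⟨?_, ?_, ?_⟩
  · rw [map_add, map_add, coeff_cube0]
    have h1' := coeff_X_pow_mul' (b ^ 3) 1 (3 * n)
    rw [pow_one] at h1'
    rw [h1', coeff_X_pow_mul']
    have h1 : (if 1 ≤ 3 * n then coeff (3 * n - 1) (b ^ 3) else 0) = 0 := by
      split_ifs with h
      · exact coeff_cube_ndvd _ _ (by omega)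
      · rfl
    have h2 : (if 2 ≤ 3 * n then coeff (3 * n - 2) (c ^ 3) else 0) = 0 := by
      split_ifs with h
      · exact coeff_cube_ndvd _ _ (by omega)
      · rfl
    rw [h1, h2]; ring
  · rw [map_add, map_add, coeff_cube_ndvd _ _ (by omega), coeff_succ_X_mul, coeff_cube0,
      coeff_X_pow_mul']
    have h2 : (if 2 ≤ 3 * n + 1 then coeff (3 * n + 1 - 2) (c ^ 3) else 0) = 0 := by
      split_ifs with h
      · exact coeff_cube_ndvd _ _ (by omega)
      · rfl
    rw [h2]; ring
  · rw [map_add, map_add, coeff_cube_ndvd _ _ (by omega), coeff_succ_X_mul,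
      coeff_cube_ndvd _ _ (by omega), coeff_X_pow_mul, coeff_cube0]
    ring

theorem secU0_comb {f : (ZMod 3)⟦X⟧} (a b c : (ZMod 3)⟦X⟧)
    (h : f = a ^ 3 + X * b ^ 3 + X ^ 2 * c ^ 3) : secU 0 f = a := by
  ext n; rw [secU, coeff_mk, h]; exact (coeff_comb a b c n).1

theorem secU1_comb {f : (ZMod 3)⟦X⟧} (a b c : (ZMod 3)⟦X⟧)
    (h : f = a ^ 3 + X * b ^ 3 + X ^ 2 * c ^ 3) : secU 1 f = b := by
  ext n; rw [secU, coeff_mk, h]; exact (coeff_comb a b c n).2.1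

theorem secU_decomp (f : (ZMod 3)⟦X⟧) :
    f = (secU 0 f) ^ 3 + X * (secU 1 f) ^ 3 + X ^ 2 * (secU 2 f) ^ 3 := by
  ext n
  have h := coeff_comb (secU 0 f) (secU 1 f) (secU 2 f) (n / 3)
  obtain h3 | h3 | h3 : n = 3 * (n / 3) ∨ n = 3 * (n / 3) + 1 ∨ n = 3 * (n / 3) + 2 := by omega
  · conv_rhs => rw [h3, h.1, secU, coeff_mk]
    rw [add_zero, ← h3]
  · conv_rhs => rw [h3, h.2.1, secU, coeff_mk]
    rw [← h3]
  · conv_rhs => rw [h3, h.2.2, secU, coeff_mk]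
    rw [← h3]

theorem main_alg (φ ψ B : (ZMod 3)⟦X⟧) (hφu : IsUnit φ)
    (hφ0 : secU 0 φ = φ ^ 3) (hφ2 : secU 2 φ = 0)
    (hψ1 : secU 1 ψ = ψ ^ 3) (hψ2 : secU 2 ψ = 0)
    (h1 : secU 1 (φ ^ 2 * ψ) = 0) (hB : B * φ ^ 2 = ψ) :
    secU 1 (secU 0 (secU 1 B)) = secU 1 B := by
  obtain ⟨O, hO⟩ : ∃ O, O = secU 1 φ := ⟨_, rfl⟩
  obtain ⟨A, hA⟩ : ∃ A, A = secU 0 ψ := ⟨_, rfl⟩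
  have dφ := secU_decomp φ
  have dψ := secU_decomp ψ
  rw [hφ0, hφ2, ← hO] at dφ
  rw [hψ1, hψ2, ← hA] at dψ
  have h3 := three_zero
  have cadd : ∀ a b : (ZMod 3)⟦X⟧, (a + b) ^ 3 = a ^ 3 + b ^ 3 := fun a b => by
    linear_combination (a ^ 2 * b + a * b ^ 2) * h3
  have dφ' : φ = φ ^ 9 + X * O ^ 3 := by linear_combination dφ
  have dψ' : ψ = A ^ 3 + X * ψ ^ 9 := by linear_combination dψ
  -- the relation
  have e1 : secU 1 (φ ^ 2 * ψ) = φ ^ 6 * ψ ^ 3 + 2 * φ ^ 3 * O * A := by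
    apply secU1_comb (φ ^ 6 * A + X * (O ^ 2 * ψ ^ 3)) _ (O ^ 2 * A + 2 * φ ^ 3 * O * ψ ^ 3)
    have key : φ ^ 2 * ψ = (φ ^ 9 + X * O ^ 3) ^ 2 * (A ^ 3 + X * ψ ^ 9) := by
      rw [← dφ', ← dψ']
    rw [key, cadd, cadd, cadd]
    linear_combination (-2 * X * φ ^ 9 * O ^ 3 * A ^ 3 - 2 * X ^ 2 * φ ^ 9 * O ^ 3 * ψ ^ 9) * h3
  obtain ⟨u, hu⟩ := hφu.exists_left_inv
  have hu3 : u ^ 3 * φ ^ 3 = 1 := by rw [← mul_pow, hu, one_pow]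
  have hOA : O * A = φ ^ 3 * ψ ^ 3 := by
    rw [h1] at e1
    have : φ ^ 3 * (O * A) = φ ^ 3 * (φ ^ 3 * ψ ^ 3) := by
      linear_combination e1 + φ ^ 3 * O * A * h3
    linear_combination u ^ 3 * this - (O * A - φ ^ 3 * ψ ^ 3) * hu3
  have hBφ : B = u ^ 3 * (φ * ψ) := by
    rw [← hB]; linear_combination (-B) * hu3
  have s1 : secU 1 B = 2 * φ ^ 2 * ψ ^ 3 := by
    have : secU 1 B = u * (φ ^ 3 * ψ ^ 3 + O * A) := by
      apply secU1_comb (u * φ ^ 3 * A) _ (u * O * ψ ^ 3)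
      have key : φ * ψ = (φ ^ 9 + X * O ^ 3) * (A ^ 3 + X * ψ ^ 9) := by
        rw [← dφ', ← dψ']
      rw [hBφ, key, mul_pow u (_ + _), cadd]
      ring
    rw [this, hOA]
    linear_combination 2 * φ ^ 2 * ψ ^ 3 * hu
  have s2 : secU 0 (secU 1 B) = 2 * ψ * φ ^ 6 := by
    apply secU0_comb _ (4 * ψ * φ ^ 3 * O) (2 * ψ * O ^ 2)
    have key : φ ^ 2 = (φ ^ 9 + X * O ^ 3) ^ 2 := by
      rw [← dφ']
    rw [s1, key]
    linear_combination (-2 * ψ ^ 3 * φ ^ 18 - 20 * X * ψ ^ 3 * φ ^ 9 * O ^ 3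
      - 2 * X ^ 2 * ψ ^ 3 * O ^ 6) * h3
  have s3 : secU 1 (secU 0 (secU 1 B)) = 2 * φ ^ 2 * ψ ^ 3 := by
    apply secU1_comb (2 * φ ^ 2 * A) _ 0
    have key : 2 * ψ * φ ^ 6 = 2 * (A ^ 3 + X * ψ ^ 9) * φ ^ 6 := by
      rw [← dψ']
    rw [s2, key]
    linear_combination (-2 * φ ^ 6 * A ^ 3 - 2 * X * φ ^ 6 * ψ ^ 9) * h3
  rw [s3, s1]
end alg

section series
open PowerSeries

open Classical in
/-- The series `φ(-q)` modulo 3. -/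
noncomputable def phiS : (ZMod 3)⟦X⟧ :=
  PowerSeries.mk fun n => if n = 0 then 1 else if IsSquare n then 2 * (-1) ^ n else 0

open Classical in
/-- The series `ψ(q)` modulo 3. -/
noncomputable def psiS : (ZMod 3)⟦X⟧ :=
  PowerSeries.mk fun n => if IsSquare (8 * n + 1) then 1 else 0

theorem isSquare_nine (n : ℕ) : IsSquare (9 * n) ↔ IsSquare n := by
  constructor
  · rintro ⟨r, hr⟩
    have h3 : 3 ∣ r := by
      have : 3 ∣ r * r := ⟨3 * n, by omega⟩
      rcases (Nat.Prime.dvd_mul Nat.prime_three).1 this with h | h <;> exact h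
    obtain ⟨k, rfl⟩ := h3
    exact ⟨k, by nlinarith⟩
  · rintro ⟨r, rfl⟩
    exact ⟨3 * r, by ring⟩

theorem isSquare_three (n : ℕ) (h : IsSquare (3 * n)) : 3 ∣ n := by
  obtain ⟨r, hr⟩ := h
  have h3 : 3 ∣ r := by
    have : 3 ∣ r * r := ⟨n, by omega⟩
    rcases (Nat.Prime.dvd_mul Nat.prime_three).1 this with h | h <;> exact h
  obtain ⟨k, rfl⟩ := h3
  exact ⟨k * k, by nlinarith⟩

theorem isSquare_mod3 (n : ℕ) (h : IsSquare n) : n % 3 ≠ 2 := by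
  obtain ⟨r, rfl⟩ := h
  have : r % 3 = 0 ∨ r % 3 = 1 ∨ r % 3 = 2 := by omega
  rcases this with h | h | h <;> simp [Nat.mul_mod, h]

theorem phi_sec0 : secU 0 phiS = phiS ^ 3 := by
  ext n
  rw [secU, coeff_mk, add_zero]
  by_cases h : 3 ∣ n
  · obtain ⟨k, rfl⟩ := h
    rw [coeff_cube0, phiS, coeff_mk, coeff_mk]
    have e : 3 * (3 * k) = 9 * k := by ring
    rw [e]
    simp only [isSquare_nine]
    have e2 : ((-1 : ZMod 3)) ^ (9 * k) = (-1) ^ k := by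
      rw [pow_mul]; congr 1
    rw [e2]
    simp
  · rw [coeff_cube_ndvd _ _ h, phiS, coeff_mk, if_neg (by omega), if_neg]
    exact fun hs => h (isSquare_three _ hs)

theorem phi_sec2 : secU 2 phiS = 0 := by
  ext n
  rw [secU, coeff_mk, phiS, coeff_mk, if_neg (by omega), if_neg, map_zero]
  exact fun hs => isSquare_mod3 _ hs (by omega)

theorem psi_sec1 : secU 1 psiS = psiS ^ 3 := by
  ext n
  rw [secU, coeff_mk]
  by_cases h : 3 ∣ n
  · obtain ⟨k, rfl⟩ := h
    rw [coeff_cube0, psiS, coeff_mk, coeff_mk]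
    have e : 8 * (3 * (3 * k) + 1) + 1 = 9 * (8 * k + 1) := by ring
    rw [e]
    simp only [isSquare_nine]
  · rw [coeff_cube_ndvd _ _ h, psiS, coeff_mk, if_neg]
    intro hs
    rw [show 8 * (3 * n + 1) + 1 = 3 * (8 * n + 3) by ring] at hs
    have := isSquare_three _ hs
    omega

theorem psi_sec2 : secU 2 psiS = 0 := by
  ext n
  rw [secU, coeff_mk, psiS, coeff_mk, if_neg, map_zero]
  exact fun hs => isSquare_mod3 _ hs (by omega)

theorem phi_theta (n : ℕ) : (X : (ZMod 3)⟦X⟧) ^ (n + 1) ∣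
    phiS - (1 + ∑ s ∈ Finset.range n, 2 * (-1) ^ (s + 1) * X ^ ((s + 1) ^ 2)) := by
  rw [X_pow_dvd_iff]
  intro m hm
  have hc : ∀ s : ℕ, coeff m (2 * (-1) ^ (s + 1) * (X : (ZMod 3)⟦X⟧) ^ ((s + 1) ^ 2)) =
      if m = (s + 1) ^ 2 then 2 * (-1) ^ (s + 1) else 0 := by
    intro s
    have : (2 * (-1) ^ (s + 1) : (ZMod 3)⟦X⟧) = C (2 * (-1) ^ (s + 1) : ZMod 3) := by
      simp only [map_mul, map_pow, map_neg, map_one, map_ofNat]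
    rw [this, coeff_C_mul, coeff_X_pow]
    split_ifs <;> simp
  rw [map_sub, map_add, map_sum, coeff_one, phiS, coeff_mk, sub_eq_zero]
  simp only [hc]
  by_cases h0 : m = 0
  · rw [if_pos h0, if_pos h0, Finset.sum_eq_zero, add_zero]
    intro s _
    rw [if_neg]
    subst h0
    exact (by positivity : 0 < (s + 1) ^ 2).ne
  · rw [if_neg h0, if_neg h0, zero_add]
    by_cases hs : IsSquare m
    · rw [if_pos hs]
      obtain ⟨r, rfl⟩ := hs
      obtain ⟨k, rfl⟩ : ∃ k, r = k + 1 := ⟨r - 1, by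
        have : r ≠ 0 := by rintro rfl; exact h0 rfl
        omega⟩
      rw [Finset.sum_eq_single k]
      · rw [if_pos (by ring), pow_mul]
        congr 1
        rcases neg_one_pow_eq_or (ZMod 3) (k + 1) with h | h <;> rw [h]
        · rw [one_pow]
        · exact h
      · intro b _ hb
        rw [if_neg]
        intro h
        apply hb
        rw [← sq] at h
        have := Nat.pow_left_injective (n := 2) (by norm_num) h
        omega
      · intro hk
        exfalso
        apply hk
        rw [Finset.mem_range]
        nlinarith
    · rw [if_neg hs, Finset.sum_eq_zero]
      intro s _
      rw [if_neg]
      rintro rfl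
      exact hs ⟨s + 1, by ring⟩

theorem psi_theta (n : ℕ) (hn : 0 < n) : (X : (ZMod 3)⟦X⟧) ^ (2 * n + 1) ∣
    psiS - ∑ s ∈ Finset.range (2 * n), X ^ (s * (s + 1) / 2) := by
  rw [X_pow_dvd_iff]
  intro m hm
  rw [map_sub, map_sum, psiS, coeff_mk, sub_eq_zero]
  simp only [coeff_X_pow]
  have htri : ∀ s : ℕ, s * (s + 1) / 2 * 2 = s * (s + 1) := fun s =>
    Nat.div_mul_cancel (Nat.even_mul_succ_self s).two_dvd
  by_cases hs : IsSquare (8 * m + 1)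
  · rw [if_pos hs]
    obtain ⟨r, hr⟩ := hs
    obtain ⟨k, rfl⟩ : ∃ k, r = 2 * k + 1 := by
      rcases Nat.even_or_odd r with ⟨j, rfl⟩ | h
      · exfalso
        have : 8 * m + 1 = 4 * (j * j) := by rw [hr]; ring
        omega
      · exact h
    have hm2 : m * 2 = k * (k + 1) := by nlinarith
    rw [Finset.sum_eq_single k]
    · rw [if_pos]
      have := htri k
      omega
    · intro b _ hb
      rw [if_neg]
      intro h
      apply hb
      have h2 := htri b
      rw [← h, hm2] at h2
      nlinarith [sq_nonneg ((b : ℤ) - k), lt_trichotomy b k]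
    · intro hk
      exfalso
      apply hk
      rw [Finset.mem_range]
      by_contra hcon
      have : 2 * n ≤ k := by omega
      nlinarith
  · rw [if_neg hs, Finset.sum_eq_zero]
    intro s _
    rw [if_neg]
    intro h
    apply hs
    have := htri s
    exact ⟨2 * s + 1, by rw [h]; nlinarith⟩

end series

section final
open PowerSeries

/-- `∏ (1 - q^(2j))`, truncated -/
noncomputable def prodE (n : ℕ) : (ZMod 3)⟦X⟧ := ∏ j ∈ Finset.range n, (1 - X ^ (2 * j + 2))

/-- `∏ (1 - q^(2j-1))`, truncated -/
noncomputable def prodO (n : ℕ) : (ZMod 3)⟦X⟧ := ∏ j ∈ Finset.range n, (1 - X ^ (2 * j + 1))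

theorem prodE_unit (n : ℕ) : IsUnit (prodE n) := by
  rw [PowerSeries.isUnit_iff_constantCoeff, prodE, map_prod]
  simp

theorem prodO_unit (n : ℕ) : IsUnit (prodO n) := by
  rw [PowerSeries.isUnit_iff_constantCoeff, prodO, map_prod]
  simp

theorem prod_even_odd (n : ℕ) :
    ∏ j ∈ Finset.range (2 * n), (1 - (X : (ZMod 3)⟦X⟧) ^ (j + 1)) = prodE n * prodO n := by
  induction n with
  | zero => simp [prodE, prodO]
  | succ n ih =>
    rw [show 2 * (n + 1) = 2 * n + 1 + 1 by ring, Finset.prod_range_succ, Finset.prod_range_succ,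
      ih]
    simp only [prodE, prodO, Finset.prod_range_succ]
    ring

theorem psi_cong (n : ℕ) (hn : 0 < n) :
    (X : (ZMod 3)⟦X⟧) ^ (2 * n + 1) ∣ psiS * prodO n - prodE n := by
  have hv : ∀ s : ℕ, (1 - (X : (ZMod 3)⟦X⟧) ^ (2 * s + 1))⁻¹ * (1 - X ^ (2 * s + 1)) = 1 :=
    fun s => PowerSeries.inv_mul_cancel _ (by simp)
  have h1 := shanks_psi_dvd (X : (ZMod 3)⟦X⟧) _ _ hv (fun s => rfl) n hn
  have h2 := psi_theta n hn
  have h3 := (dvd_add h2 h1).mul_right (prodO n)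
  have h4 : (∏ j ∈ Finset.range n, ((1 - X ^ (2 * j + 2)) *
      (1 - (X : (ZMod 3)⟦X⟧) ^ (2 * j + 1))⁻¹)) * prodO n = prodE n := by
    rw [prodO, prodE, ← Finset.prod_mul_distrib]
    refine Finset.prod_congr rfl fun j _ => ?_
    rw [mul_assoc, hv, mul_one]
  convert h3 using 1
  rw [← h4]
  ring

theorem prod_dvd_sub_one (n : ℕ) (k : ℕ) :
    (X : (ZMod 3)⟦X⟧) ^ (2 * n + 1) ∣ (∏ j ∈ Finset.Ico n (n + k), (1 - X ^ (2 * j + 2))) - 1 := by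
  induction k with
  | zero => simp
  | succ k ih =>
    rw [← add_assoc, Finset.prod_Ico_succ_top (by omega)]
    have : (X : (ZMod 3)⟦X⟧) ^ (2 * n + 1) ∣ X ^ (2 * (n + k) + 2) := pow_dvd_pow _ (by omega)
    have h := dvd_sub ih
      (this.mul_left (∏ j ∈ Finset.Ico n (n + k), (1 - (X : (ZMod 3)⟦X⟧) ^ (2 * j + 2))))
    convert h using 1
    ring

theorem phi_cong (n : ℕ) :
    (X : (ZMod 3)⟦X⟧) ^ (2 * n + 1) ∣ phiS - prodE n * prodO n ^ 2 := by
  have hv : ∀ s : ℕ, (1 + (X : (ZMod 3)⟦X⟧) ^ (s + 1))⁻¹ * (1 + X ^ (s + 1)) = 1 :=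
    fun s => PowerSeries.inv_mul_cancel _ (by simp)
  have h1 := shanks_phi_dvd (X : (ZMod 3)⟦X⟧) _ _ hv (fun s => rfl) (2 * n)
  have h2 := dvd_add (phi_theta (2 * n)) h1
  obtain ⟨D, hD⟩ : ∃ D, D = ∏ j ∈ Finset.range (2 * n), (1 + (X : (ZMod 3)⟦X⟧) ^ (j + 1)) :=
    ⟨_, rfl⟩
  have h4 : (∏ j ∈ Finset.range (2 * n), ((1 - X ^ (j + 1)) *
      (1 + (X : (ZMod 3)⟦X⟧) ^ (j + 1))⁻¹)) * D = prodE n * prodO n := by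
    rw [← prod_even_odd, hD, ← Finset.prod_mul_distrib]
    refine Finset.prod_congr rfl fun j _ => ?_
    rw [mul_assoc, hv, mul_one]
  have h5 : D * (prodE n * prodO n) =
      prodE n * ∏ j ∈ Finset.Ico n (n + n), (1 - X ^ (2 * j + 2)) := by
    rw [← prod_even_odd, hD, ← Finset.prod_mul_distrib, prodE, Finset.range_eq_Ico,
      Finset.range_eq_Ico, Finset.prod_Ico_consecutive _ (Nat.zero_le n) (by omega), two_mul]
    refine Finset.prod_congr rfl fun j _ => ?_
    ring
  have h6 := prod_dvd_sub_one n n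
  obtain ⟨i, hi⟩ := (prodE_unit n).exists_left_inv
  generalize (∏ j ∈ Finset.Ico n (n + n), (1 - (X : (ZMod 3)⟦X⟧) ^ (2 * j + 2))) = T at h5 h6
  generalize (∏ j ∈ Finset.range (2 * n), ((1 - X ^ (j + 1)) *
      (1 + (X : (ZMod 3)⟦X⟧) ^ (j + 1))⁻¹)) = P at h4 h2
  have hDo : D * prodO n = T := by
    linear_combination i * h5 - (D * prodO n - T) * hi
  -- φ - e o² = (φ - P) D o - (φ) (T - 1)
  have h7 := dvd_sub (h2.mul_right (D * prodO n)) (h6.mul_left phiS)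
  convert h7 using 1
  linear_combination (-phiS) * hDo + prodO n * h4

/-- The allowed parts of size at most `2n`. -/
def partsF (n : ℕ) : Finset (ℕ × ℕ) :=
  (Finset.range n).image (fun j => (2 * j + 2, 1)) ∪
    ((Finset.range n) ×ˢ (Finset.Icc 1 5)).image (fun p => (2 * p.1 + 1, p.2))

theorem mem_partsF (n : ℕ) (p : ℕ × ℕ) : p ∈ partsF n ↔
    p.1 ≤ 2 * n ∧ 0 < p.1 ∧ 1 ≤ p.2 ∧ p.2 ≤ 5 ∧ (Even p.1 → p.2 = 1) := by
  obtain ⟨m, c⟩ := p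
  simp only [partsF, Finset.mem_union, Finset.mem_image, Finset.mem_range, Finset.mem_product,
    Finset.mem_Icc, Prod.mk.injEq, Prod.exists]
  constructor
  · rintro (⟨j, hj, rfl, rfl⟩ | ⟨j, d, ⟨hj, hd⟩, rfl, rfl⟩)
    · refine ⟨by omega, by omega, by omega, by omega, fun _ => rfl⟩
    · refine ⟨by omega, by omega, by omega, by omega, fun h => ?_⟩
      rw [Nat.even_iff] at h
      omega
  · rintro ⟨h1, h2, h3, h4, h5⟩
    rcases Nat.even_or_odd m with h | h
    · left
      have := h5 h
      rw [Nat.even_iff] at h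
      exact ⟨m / 2 - 1, by omega, by omega, by omega⟩
    · right
      rw [Nat.odd_iff] at h
      exact ⟨m / 2, c, by omega, by omega, rfl⟩

theorem prod_partsF (n : ℕ) :
    ∏ p ∈ partsF n, (1 - (X : (ZMod 3)⟦X⟧) ^ p.1) = prodE n * prodO n ^ 5 := by
  rw [partsF, Finset.prod_union, Finset.prod_image, Finset.prod_image, Finset.prod_product]
  · simp [prodE, prodO, Finset.prod_pow]
  · rintro ⟨a, b⟩ _ ⟨c, d⟩ _ h
    simp only [Prod.mk.injEq] at h ⊢
    omega
  · intro a _ b _ h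
    simp only [Prod.mk.injEq] at h
    omega
  · rw [Finset.disjoint_left]
    intro p hp hq
    simp only [Finset.mem_image, Finset.mem_range, Finset.mem_product, Prod.exists] at hp hq
    obtain ⟨j, _, rfl⟩ := hp
    obtain ⟨k, d, _, h⟩ := hq
    simp only [Prod.mk.injEq] at h
    omega

theorem a_eq_ncard (n m : ℕ) (h : m ≤ 2 * n) : a 5 m = (wset (partsF n) m).ncard := by
  rw [a, Nat.card_coe_set_eq]
  congr 1
  ext s
  simp only [wset, coloredOddPartitions, Set.mem_ofPred_eq]
  refine and_congr_left fun hs => forall₂_congr fun p hp => ?_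
  rw [mem_partsF]
  have := Multiset.single_le_sum (s := s.map Prod.fst) (fun _ _ => Nat.zero_le _) p.1
      (Multiset.mem_map_of_mem _ hp)
  exact ⟨fun H => ⟨by omega, H⟩, fun H => H.2⟩

/-- The generating function of `a 5` modulo 3. -/
noncomputable def genB : (ZMod 3)⟦X⟧ := PowerSeries.mk fun n => (a 5 n : ZMod 3)

theorem genB_cong (n : ℕ) :
    (X : (ZMod 3)⟦X⟧) ^ (2 * n + 1) ∣ genB * (prodE n * prodO n ^ 5) - 1 := by
  have h := wset_genfun (ZMod 3) (partsF n) (fun p hp => ((mem_partsF n p).1 hp).2.1)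
  rw [prod_partsF] at h
  rw [← h, ← sub_mul]
  apply Dvd.dvd.mul_right
  rw [X_pow_dvd_iff]
  intro m hm
  rw [map_sub, genB, coeff_mk, coeff_mk, a_eq_ncard n m (by omega), sub_self]

theorem genB_phi : genB * phiS ^ 2 = psiS := by
  rw [← sub_eq_zero]
  ext m
  rw [map_zero]
  have hd : (X : (ZMod 3)⟦X⟧) ^ (2 * (m + 1) + 1) ∣ genB * phiS ^ 2 - psiS := by
    have h1 := psi_cong (m + 1) (by omega)
    have h2 := phi_cong (m + 1)
    have h3 := genB_cong (m + 1)
    obtain ⟨i, hi⟩ := (prodO_unit (m + 1)).exists_left_inv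
    generalize prodO (m + 1) = o at *
    generalize prodE (m + 1) = e at *
    -- (B φ² - ψ) o
    have h4 : genB * phiS ^ 2 - psiS =
        i * ((phiS - e * o ^ 2) * (genB * (phiS + e * o ^ 2) * o)
          + (genB * (e * o ^ 5) - 1) * e - (psiS * o - e)) := by
      linear_combination (-(genB * phiS ^ 2 - psiS)) * hi
    rw [h4]
    exact ((dvd_sub (dvd_add (h2.mul_right _) (h3.mul_right _)) h1)).mul_left _
  exact X_pow_dvd_iff.1 hd m (by omega)

theorem sec_phi_psi : secU 1 (phiS ^ 2 * psiS) = 0 := by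
  ext m
  rw [map_zero, secU, coeff_mk]
  have h1 := psi_cong (3 * m + 1) (by omega)
  have h2 := phi_cong (3 * m + 1)
  generalize prodO (3 * m + 1) = o at *
  generalize prodE (3 * m + 1) = e at *
  have hd : (X : (ZMod 3)⟦X⟧) ^ (2 * (3 * m + 1) + 1) ∣ phiS ^ 2 * psiS - (e * o) ^ 3 := by
    have h4 : phiS ^ 2 * psiS - (e * o) ^ 3 =
      (phiS - e * o ^ 2) * ((phiS + e * o ^ 2) * psiS) + (psiS * o - e) * (e ^ 2 * o ^ 3) := by ring
    rw [h4]
    exact dvd_add (h2.mul_right _) (h1.mul_right _)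
  have := X_pow_dvd_iff.1 hd (3 * m + 1) (by omega)
  rw [map_sub, coeff_cube_ndvd _ _ (by omega), sub_zero] at this
  exact this

theorem phi_unit : IsUnit phiS := by
  rw [PowerSeries.isUnit_iff_constantCoeff, ← coeff_zero_eq_constantCoeff_apply, phiS, coeff_mk]
  simp

end final

theorem stmt11 (n : ℕ) : a 5 (81 * n + 10) ≡ a 5 (9 * n + 1) [MOD 3] := by
  have h := main_alg phiS psiS genB phi_unit phi_sec0 phi_sec2 psi_sec1 psi_sec2 sec_phi_psi
    genB_phi
  have h2 := congrArg (PowerSeries.coeff (3 * n)) h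
  simp only [secU, PowerSeries.coeff_mk, genB] at h2
  rw [← ZMod.natCast_eq_natCast_iff]
  convert h2 using 3
  · ring
  · ring
end

section
/- For all integers n ≥ 0, a_8(27n + 20) ≡ 0 (mod 3). -/
open PowerSeries

namespace Pf

abbrev S := PowerSeries (ZMod 3)

noncomputable def U (r : ℕ) (G : S) : S := PowerSeries.mk fun n => coeff (3 * n + r) G

lemma coeff_cube (H : S) (n : ℕ) :
    coeff n (H ^ 3) = if 3 ∣ n then coeff (n / 3) H else 0 := by
  have : Fact (Nat.Prime 3) := ⟨Nat.prime_three⟩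
  have h : H ^ 3 = PowerSeries.expand 3 (by norm_num) H := by
    rw [← MvPowerSeries.map_frobenius_expand 3 (by norm_num), ZMod.frobenius_zmod]
    rw [MvPowerSeries.map_id]; rfl
  rw [h, PowerSeries.coeff_expand]

lemma decomp (G : S) : G = (U 0 G) ^ 3 + X * (U 1 G) ^ 3 + X ^ 2 * (U 2 G) ^ 3 := by
  ext n
  obtain ⟨m, h | h | h⟩ : ∃ m, n = 3 * m ∨ n = 3 * m + 1 ∨ n = 3 * m + 1 + 1 := ⟨n / 3, by omega⟩
  all_goals subst h
  · rcases m with _ | m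
    · simp [coeff_cube, U, pow_two, mul_assoc]
    · rw [show 3 * (m + 1) = 3 * m + 1 + 1 + 1 by ring]
      simp only [pow_two, mul_assoc, map_add, coeff_succ_X_mul, coeff_cube]
      rw [if_pos (by omega), if_neg (by omega), if_neg (by omega)]
      simp only [U, coeff_mk, add_zero]
      congr 2; omega
  · rcases m with _ | m
    · simp [coeff_cube, U, pow_two, mul_assoc, coeff_succ_X_mul]
    · rw [show 3 * (m + 1) + 1 = 3 * m + 1 + 1 + 1 + 1 by ring]
      simp only [pow_two, mul_assoc, map_add, coeff_succ_X_mul, coeff_cube]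
      rw [if_neg (by omega), if_pos (by omega), if_neg (by omega)]
      simp only [U, coeff_mk, add_zero, zero_add]
      congr 2; omega
  · simp only [pow_two, mul_assoc, map_add, coeff_succ_X_mul, coeff_cube]
    rw [if_neg (by omega), if_neg (by omega), if_pos (by omega)]
    simp only [U, coeff_mk, add_zero, zero_add]
    congr 2; omega

lemma U0_of (A B C : S) : U 0 (A ^ 3 + X * B ^ 3 + X ^ 2 * C ^ 3) = A := by
  ext n
  simp only [U, coeff_mk]
  rcases n with _ | m
  · simp [coeff_cube, pow_two, mul_assoc]
  · rw [show 3 * (m + 1) + 0 = 3 * m + 1 + 1 + 1 by ring]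
    simp only [pow_two, mul_assoc, map_add, coeff_succ_X_mul, coeff_cube]
    rw [if_pos (by omega), if_neg (by omega), if_neg (by omega)]
    simp only [add_zero]
    congr 2; omega

lemma U1_of (A B C : S) : U 1 (A ^ 3 + X * B ^ 3 + X ^ 2 * C ^ 3) = B := by
  ext n
  simp only [U, coeff_mk]
  rcases n with _ | m
  · simp [coeff_cube, pow_two, mul_assoc, coeff_succ_X_mul, coeff_one]
  · rw [show 3 * (m + 1) + 1 = 3 * m + 1 + 1 + 1 + 1 by ring]
    simp only [pow_two, mul_assoc, map_add, coeff_succ_X_mul, coeff_cube]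
    rw [if_neg (by omega), if_pos (by omega), if_neg (by omega)]
    simp only [add_zero, zero_add]
    congr 2; omega

lemma U2_of (A B C : S) : U 2 (A ^ 3 + X * B ^ 3 + X ^ 2 * C ^ 3) = C := by
  ext n
  simp only [U, coeff_mk]
  rw [show 3 * n + 2 = 3 * n + 1 + 1 by ring]
  simp only [pow_two, mul_assoc, map_add, coeff_succ_X_mul, coeff_cube]
  rw [if_neg (by omega), if_neg (by omega), if_pos (by omega)]
  simp only [add_zero, zero_add]
  congr 2; omega

lemma U0_mul (G H : S) : U 0 (G * H ^ 3) = U 0 G * H := by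
  conv_lhs => rw [decomp G]
  rw [← U0_of (U 0 G * H) (U 1 G * H) (U 2 G * H)]
  congr 1; ring

lemma U2_mul (G H : S) : U 2 (G * H ^ 3) = U 2 G * H := by
  conv_lhs => rw [decomp G]
  rw [← U2_of (U 0 G * H) (U 1 G * H) (U 2 G * H)]
  congr 1; ring

lemma three_S : (3 : S) = 0 := by
  have : (3 : ZMod 3) = 0 := by decide
  have h := congrArg (PowerSeries.C (R := ZMod 3)) this
  rw [map_zero] at h
  rw [← h, map_ofNat]

/-- The algebraic core. -/
lemma core (F f1 f2 P Q : S) (h1 : IsUnit f1) (h2 : IsUnit f2)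
    (hF : F * f1 ^ 8 = f2 ^ 7) (hP : P * f1 = 2 * f2 ^ 2) (hQ : Q * f2 = f1 ^ 2)
    (P1 : U 1 P = P ^ 3) (P2 : U 2 P = 0) (Q0 : U 0 Q = Q ^ 3) (Q2 : U 2 Q = 0) (n : ℕ) :
    coeff (27 * n + 20) F = 0 := by
  have h3 := three_S
  have uQ : IsUnit Q := by
    have : IsUnit (Q * f2) := by rw [hQ]; exact h1.pow 2
    exact isUnit_of_mul_isUnit_left this
  have e1 : F * Q ^ 3 = P ^ 2 := by
    apply (((h1.pow 8).mul (h2.pow 3)).mul_left_inj).1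
    have : P ^ 2 * (f1 ^ 8 * f2 ^ 3) = (P * f1) ^ 2 * f1 ^ 6 * f2 ^ 3 := by ring
    rw [this, hP]
    have : F * Q ^ 3 * (f1 ^ 8 * f2 ^ 3) = (F * f1 ^ 8) * (Q * f2) ^ 3 := by ring
    rw [this, hQ, hF]
    linear_combination (-f1 ^ 6 * f2 ^ 7) * h3
  have e2 : U 2 F * Q = P ^ 6 := by
    rw [← U2_mul, e1]
    rw [← U2_of ((U 0 P) ^ 2) (2 * U 0 P * P ^ 3) (P ^ 6)]
    congr 1
    have hd := decomp P
    rw [P1, P2] at hd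
    conv_lhs => rw [hd]
    linear_combination (-2 * X * (U 0 P) ^ 3 * P ^ 9) * h3
  have e3 : U 0 (Q ^ 2) = Q ^ 6 := by
    refine Eq.trans ?_ (U0_of (Q ^ 6) (2 * Q ^ 3 * U 1 Q) ((U 1 Q) ^ 2))
    congr 1
    have hd := decomp Q
    rw [Q0, Q2] at hd
    conv_lhs => rw [hd]
    linear_combination (-2 * X * (U 1 Q) ^ 3 * Q ^ 9) * h3
  have e4 : U 0 (U 2 F) = Q ^ 5 * P ^ 2 := by
    apply (uQ.mul_left_inj).1
    rw [← U0_mul]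
    have : U 2 F * Q ^ 3 = Q ^ 2 * (P ^ 2) ^ 3 := by linear_combination Q ^ 2 * e2
    rw [this, U0_mul, e3]; ring
  have e5 : Q ^ 2 * P ^ 2 = 2 * f1 ^ 3 * P := by
    apply (((h1.pow 2).mul (h2.pow 2)).mul_left_inj).1
    have a1 : Q ^ 2 * P ^ 2 * (f1 ^ 2 * f2 ^ 2) = (Q * f2) ^ 2 * (P * f1) ^ 2 := by ring
    have a2 : 2 * f1 ^ 3 * P * (f1 ^ 2 * f2 ^ 2) = 2 * f1 ^ 4 * f2 ^ 2 * (P * f1) := by ring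
    rw [a1, a2, hQ, hP]; ring
  have e6 : U 2 (U 0 (U 2 F)) = 0 := by
    have : U 0 (U 2 F) = P * (2 * f1 * Q) ^ 3 := by
      rw [e4]
      linear_combination Q ^ 3 * e5 - 2 * f1 ^ 3 * P * Q ^ 3 * h3
    rw [this, U2_mul, P2, zero_mul]
  have e7 := congrArg (coeff n) e6
  simp only [U, coeff_mk, map_zero] at e7
  rw [← e7]
  congr 2; ring

/-! counting -/

def W (T : Finset (ℕ × ℕ)) (n : ℕ) : Set (Multiset (ℕ × ℕ)) :=
  {s | (∀ p ∈ s, p ∈ T) ∧ (s.map Prod.fst).sum = n}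

lemma W_empty (n : ℕ) : W ∅ n = if n = 0 then {0} else ∅ := by
  ext s
  have : (∀ p ∈ s, p ∈ (∅ : Finset (ℕ × ℕ))) ↔ s = 0 := by
    simp [Multiset.eq_zero_iff_forall_notMem]
  simp only [W, Set.mem_ofPred_eq, this]
  split_ifs with h
  · subst h; simp +contextual
  · simp only [Set.mem_empty_iff_false, iff_false, not_and]
    rintro rfl; simpa using Ne.symm h

lemma W_insert (T : Finset (ℕ × ℕ)) (p : ℕ × ℕ) (n : ℕ) :
    W (insert p T) n = W T n ∪ (if p.1 ≤ n then (fun s => p ::ₘ s) '' W (insert p T) (n - p.1) else ∅) := by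
  ext s
  constructor
  · rintro ⟨h1, h2⟩
    by_cases hp : p ∈ s
    · right
      obtain ⟨t, rfl⟩ := Multiset.exists_cons_of_mem hp
      simp only [Multiset.map_cons, Multiset.sum_cons] at h2
      rw [if_pos (by omega)]
      exact ⟨t, ⟨fun q hq => h1 q (Multiset.mem_cons_of_mem hq), by omega⟩, rfl⟩
    · left
      refine ⟨fun q hq => ?_, h2⟩
      rcases Finset.mem_insert.1 (h1 q hq) with h | h
      · exact absurd (h ▸ hq) hp
      · exact h
  · rintro (⟨h1, h2⟩ | h)
    · exact ⟨fun q hq => Finset.mem_insert_of_mem (h1 q hq), h2⟩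
    · split_ifs at h with hle
      · obtain ⟨t, ⟨h1, h2⟩, rfl⟩ := h
        refine ⟨fun q hq => ?_, ?_⟩
        · rcases Multiset.mem_cons.1 hq with h | h
          · subst h; exact Finset.mem_insert_self _ _
          · exact h1 q h
        · simp only [Multiset.map_cons, Multiset.sum_cons]; omega
      · exact absurd h (Set.notMem_empty _)

lemma W_finite (T : Finset (ℕ × ℕ)) (hT : ∀ p ∈ T, 0 < p.1) (n : ℕ) : (W T n).Finite := by
  induction T using Finset.induction_on generalizing n with
  | empty => rw [W_empty]; split_ifs <;> simp
  | insert p T hp ih =>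
    have ih' := ih (fun q hq => hT q (Finset.mem_insert_of_mem hq))
    have hp0 := hT p (Finset.mem_insert_self _ _)
    induction n using Nat.strong_induction_on with
    | _ n ihn =>
      rw [W_insert]
      refine (ih' n).union ?_
      split_ifs with h
      · exact (ihn _ (by omega)).image _
      · exact Set.finite_empty

noncomputable def GF (T : Finset (ℕ × ℕ)) : S := PowerSeries.mk fun n => ((W T n).ncard : ZMod 3)

lemma GF_insert (T : Finset (ℕ × ℕ)) (p : ℕ × ℕ) (hT : ∀ q ∈ insert p T, 0 < q.1) (hp : p ∉ T) :
    GF (insert p T) * (1 - X ^ p.1) = GF T := by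
  have : GF (insert p T) = GF T + GF (insert p T) * X ^ p.1 := by
    ext n
    rw [map_add, coeff_mul_X_pow']
    simp only [GF, coeff_mk]
    conv_lhs => rw [W_insert]
    rw [Set.ncard_union_eq ?_ ?_ ?_]
    · push_cast
      congr 1
      split_ifs with h
      · rw [Set.ncard_image_of_injective]
        intro a b hab; simpa using hab
      · simp
    · rw [Set.disjoint_left]
      rintro s ⟨h1, -⟩ h
      split_ifs at h with h'
      · obtain ⟨t, -, rfl⟩ := h
        exact hp (h1 p (Multiset.mem_cons_self _ _))
      · exact h
    · exact W_finite T (fun q hq => hT q (Finset.mem_insert_of_mem hq)) n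
    · split_ifs
      · exact (W_finite _ hT _).image _
      · exact Set.finite_empty
  linear_combination this

lemma GF_prod (T : Finset (ℕ × ℕ)) (hT : ∀ p ∈ T, 0 < p.1) :
    GF T * ∏ p ∈ T, (1 - X ^ p.1) = 1 := by
  induction T using Finset.induction_on with
  | empty =>
    ext n
    simp only [GF, W_empty, Finset.prod_empty, mul_one, coeff_mk, coeff_one]
    split_ifs <;> simp
  | insert p T hp ih =>
    rw [Finset.prod_insert hp, ← mul_assoc, GF_insert T p hT hp,
      ih (fun q hq => hT q (Finset.mem_insert_of_mem hq))]

def TT (N : ℕ) : Finset (ℕ × ℕ) :=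
  (Finset.Icc 1 N ×ˢ Finset.Icc 1 8).filter fun p => Even p.1 → p.2 = 1

lemma a_eq (N n : ℕ) (h : n ≤ N) : a 8 n = (W (TT N) n).ncard := by
  rw [a, Nat.card_coe_set_eq]
  congr 1
  ext s
  simp only [coloredOddPartitions, W, Set.mem_ofPred_eq, TT, Finset.mem_filter, Finset.mem_product,
    Finset.mem_Icc]
  refine and_congr_left fun hs => forall₂_congr fun p hp => ?_
  have : p.1 ≤ n := by
    rw [← hs]
    exact Multiset.single_le_sum (fun _ _ => Nat.zero_le _) _ (Multiset.mem_map_of_mem _ hp)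
  constructor
  · rintro ⟨h1, h2, h3, h4⟩; exact ⟨⟨⟨h1, by omega⟩, h2, h3⟩, h4⟩
  · rintro ⟨⟨⟨h1, _⟩, h2, h3⟩, h4⟩; exact ⟨h1, h2, h3, h4⟩

noncomputable def e (c n : ℕ) : S := ∏ i ∈ Finset.range n, (1 - (X ^ c) ^ (i + 1))

noncomputable def od (n : ℕ) : S := ∏ i ∈ Finset.range n, (1 - X ^ (2 * i + 1))

lemma od_mul (n : ℕ) : od n * e 2 n = e 1 (2 * n) := by
  induction n with
  | zero => simp [od, e]
  | succ n ih =>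
    rw [show 2 * (n + 1) = 2 * n + 1 + 1 by ring]
    simp only [od, e, Finset.prod_range_succ] at ih ⊢
    rw [← ih]
    ring

lemma TT_prod (n : ℕ) : ∏ p ∈ TT (2 * n), (1 - X ^ p.1 : S) = od n ^ 8 * e 2 n := by
  have h (N : ℕ) : ∏ p ∈ TT N, (1 - X ^ p.1 : S) =
      ∏ m ∈ Finset.Icc 1 N, if Even m then (1 - X ^ m : S) else (1 - X ^ m) ^ 8 := by
    rw [TT, Finset.prod_filter, Finset.prod_product]
    refine Finset.prod_congr rfl fun m _ => ?_
    by_cases hm : Even m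
    · simp only [hm, if_true, forall_const]
      rw [Finset.prod_ite_eq' (Finset.Icc 1 8) 1]
      simp
    · simp [hm]
  rw [h]
  induction n with
  | zero => simp [od, e]
  | succ n ih =>
    rw [show 2 * (n + 1) = 2 * n + 1 + 1 by ring, Finset.prod_Icc_succ_top (by omega),
      Finset.prod_Icc_succ_top (by omega), ih, if_neg (by simp), if_pos (by grind)]
    simp only [od, e, Finset.prod_range_succ]
    ring

lemma GF_main (n : ℕ) : GF (TT (2 * n)) * e 1 (2 * n) ^ 8 = e 2 n ^ 7 := by
  have h := GF_prod (TT (2 * n)) (by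
    intro p hp
    simp only [TT, Finset.mem_filter, Finset.mem_product, Finset.mem_Icc] at hp
    omega)
  rw [TT_prod] at h
  rw [← od_mul]
  linear_combination e 2 n ^ 7 * h

noncomputable def FF : S := PowerSeries.mk fun n => (a 8 n : ZMod 3)

/-! convergence -/

def Conv (u : ℕ → S) (L : S) : Prop := ∀ m : ℕ, ∃ N, ∀ n ≥ N, (X : S) ^ m ∣ u n - L

lemma Conv.mul {u v : ℕ → S} {L M : S} (hu : Conv u L) (hv : Conv v M) :
    Conv (fun n => u n * v n) (L * M) := by
  intro m
  obtain ⟨N, hN⟩ := hu m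
  obtain ⟨N', hN'⟩ := hv m
  refine ⟨max N N', fun n hn => ?_⟩
  have : u n * v n - L * M = u n * (v n - M) + (u n - L) * M := by ring
  rw [this]
  exact dvd_add (Dvd.dvd.mul_left (hN' n (le_trans (le_max_right _ _) hn)) _)
    (Dvd.dvd.mul_right (hN n (le_trans (le_max_left _ _) hn)) _)

lemma Conv.const (L : S) : Conv (fun _ => L) L := fun m => ⟨0, fun n _ => by simp⟩

lemma Conv.pow {u : ℕ → S} {L : S} (hu : Conv u L) (k : ℕ) : Conv (fun n => u n ^ k) (L ^ k) := by
  induction k with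
  | zero => simpa using Conv.const 1
  | succ k ih => simpa only [pow_succ] using ih.mul hu

lemma Conv.unique {u : ℕ → S} {L M : S} (hu : Conv u L) (hv : Conv u M) : L = M := by
  ext d
  obtain ⟨N, hN⟩ := hu (d + 1)
  obtain ⟨N', hN'⟩ := hv (d + 1)
  have h1 := X_pow_dvd_iff.1 (hN _ (le_max_left N N')) d (by omega)
  have h2 := X_pow_dvd_iff.1 (hN' _ (le_max_right N N')) d (by omega)
  rw [map_sub, sub_eq_zero] at h1 h2
  rw [← h1, h2]

lemma Conv.cancel {u w : ℕ → S} {L M : S} (hM : IsUnit M) (hu : Conv (fun n => u n * w n) (L * M))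
    (hw : Conv w M) : Conv u L := by
  intro m
  obtain ⟨N, hN⟩ := hu m
  obtain ⟨N', hN'⟩ := hw m
  refine ⟨max N N', fun n hn => ?_⟩
  rw [← hM.dvd_mul_right]
  have : (u n - L) * M = (u n * w n - L * M) - u n * (w n - M) := by ring
  rw [this]
  exact dvd_sub (hN n (le_trans (le_max_left _ _) hn))
    (Dvd.dvd.mul_left (hN' n (le_trans (le_max_right _ _) hn)) _)

lemma Conv.comp {u : ℕ → S} {L : S} (hu : Conv u L) (φ : ℕ → ℕ) (k : ℕ) (hφ : ∀ n, n ≤ φ n + k) :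
    Conv (fun n => u (φ n)) L := by
  intro m
  obtain ⟨N, hN⟩ := hu m
  exact ⟨N + k, fun n hn => hN _ (by have := hφ n; omega)⟩

lemma Conv.congr {u v : ℕ → S} {L : S} (hu : Conv u L) (N : ℕ) (h : ∀ n ≥ N, u n = v n) :
    Conv v L := by
  intro m
  obtain ⟨N', hN⟩ := hu m
  exact ⟨max N N', fun n hn => by
    rw [← h n (le_trans (le_max_left _ _) hn)]; exact hN n (le_trans (le_max_right _ _) hn)⟩

noncomputable def f (c : ℕ) : S := PowerSeries.mk fun n => coeff n (e c n)

lemma e_stab (c : ℕ) (hc : 0 < c) (d k : ℕ) : coeff d (e c (d + k)) = coeff d (e c d) := by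
  induction k with
  | zero => rfl
  | succ k ih =>
    rw [← ih, ← add_assoc, e, Finset.prod_range_succ, ← e, mul_sub, mul_one, map_sub, ← pow_mul,
      coeff_mul_X_pow', if_neg (by nlinarith), sub_zero]

lemma conv_e (c : ℕ) (hc : 0 < c) : Conv (e c) (f c) := by
  intro m
  refine ⟨m, fun n hn => X_pow_dvd_iff.2 fun d hd => ?_⟩
  obtain ⟨k, rfl⟩ := Nat.exists_eq_add_of_le (show d ≤ n by omega)
  rw [map_sub, e_stab c hc, f, coeff_mk, sub_self]

lemma f_unit (c : ℕ) : IsUnit (f c) := by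
  rw [PowerSeries.isUnit_iff_constantCoeff]
  simp [f, e]

lemma conv_FF : Conv (fun n => GF (TT (2 * n))) FF := by
  intro m
  refine ⟨m, fun n hn => X_pow_dvd_iff.2 fun d hd => ?_⟩
  simp only [map_sub, GF, FF, coeff_mk]
  rw [a_eq (2 * n) d (by omega), sub_self]

lemma FF_eq : FF * f 1 ^ 8 = f 2 ^ 7 := by
  have h1 := conv_FF.mul (((conv_e 1 one_pos).comp (fun n => 2 * n) 0 (by intro n; omega)).pow 8)
  simp only [GF_main] at h1
  exact h1.unique ((conv_e 2 two_pos).pow 7)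

/-! theta series -/

noncomputable def Th (t : ℤ → ℕ) (ε : ℤ → ZMod 3) : S :=
  PowerSeries.mk fun d => ∑ j ∈ Finset.Icc (-((d : ℤ) + 1)) (d + 1), if t j = d then ε j else 0

lemma coeff_Th (t : ℤ → ℕ) (ε : ℤ → ZMod 3) (ht : ∀ j, |j| ≤ t j + 1) (d : ℕ) (B : Finset ℤ)
    (hB : Finset.Icc (-((d : ℤ) + 1)) (d + 1) ⊆ B) :
    coeff d (Th t ε) = ∑ j ∈ B, if t j = d then ε j else 0 := by
  rw [Th, coeff_mk]
  refine Finset.sum_subset hB fun j _ hj => if_neg ?_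
  rintro rfl
  exact hj (Finset.mem_Icc.2 (abs_le.1 (ht j)))

lemma tannery (t : ℤ → ℕ) (ε : ℤ → ZMod 3) (ht : ∀ j, |j| ≤ t j + 1) (u : ℕ → ℤ → S)
    (hu : ∀ j, Conv (fun n => u n j) 1) :
    Conv (fun n => ∑ j ∈ Finset.Icc (-(n : ℤ)) n, u n j * (C (ε j) * X ^ t j)) (Th t ε) := by
  intro m
  have h1 : ∀ᶠ n in Filter.atTop, ∀ j ∈ Finset.Icc (-((m : ℤ) + 1)) (m + 1), (X : S) ^ m ∣ u n j - 1 := by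
    rw [Finset.eventually_all]
    intro j _
    exact Filter.eventually_atTop.2 (hu j m)
  obtain ⟨N, hN⟩ := Filter.eventually_atTop.1 h1
  refine ⟨max N (m + 1), fun n hn => X_pow_dvd_iff.2 fun d hd => ?_⟩
  have hnN : N ≤ n := le_trans (le_max_left _ _) hn
  have hnm : m + 1 ≤ n := le_trans (le_max_right _ _) hn
  rw [map_sub, coeff_Th t ε ht d (Finset.Icc (-(n : ℤ)) n)
    (Finset.Icc_subset_Icc (by omega) (by omega)), map_sum, sub_eq_zero]
  refine Finset.sum_congr rfl fun j _ => ?_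
  have h0 : coeff d (C (ε j) * X ^ t j : S) = if t j = d then ε j else 0 := by
    rw [coeff_C_mul, coeff_X_pow]
    simp [eq_comm]
  rw [← h0]
  by_cases hj : j ∈ Finset.Icc (-((m : ℤ) + 1)) (m + 1)
  · have := (hN n hnN j hj).mul_right (C (ε j) * X ^ t j)
    have := X_pow_dvd_iff.1 this d hd
    rw [sub_mul, one_mul, map_sub, sub_eq_zero] at this
    exact this
  · have htj : d < t j := by
      have h2 := ht j
      have h3 : ¬ |j| ≤ (m : ℤ) + 1 := fun h => hj (Finset.mem_Icc.2 (abs_le.1 h))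
      omega
    rw [h0, if_neg (by omega), ← mul_assoc, coeff_mul_X_pow', if_neg (by omega)]

lemma U_Th_zero (t : ℤ → ℕ) (ε : ℤ → ZMod 3) (r : ℕ) (h : ∀ j n, t j ≠ 3 * n + r) :
    U r (Th t ε) = 0 := by
  ext n
  rw [U, coeff_mk, Th, coeff_mk, map_zero]
  exact Finset.sum_eq_zero fun j _ => if_neg (h j n)

lemma U_Th (t : ℤ → ℕ) (ε : ℤ → ZMod 3) (ht : ∀ j, |j| ≤ t j + 1) (r : ℕ) (φ : ℤ → ℤ)
    (hφ : Function.Injective φ) (h1 : ∀ j n, t j = 3 * n + r → ∃ i, φ i = j)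
    (h2 : ∀ i, t (φ i) = 9 * t i + r) (h3 : ∀ i, ε (φ i) = ε i) :
    U r (Th t ε) = Th t ε ^ 3 := by
  ext n
  rw [U, coeff_mk, coeff_cube]
  set A : Finset ℤ := Finset.Icc (-((n : ℤ) + 1)) (n + 1) with hA
  set B : Finset ℤ := Finset.Icc (-(((3 * n + r : ℕ) : ℤ) + 1)) ((3 * n + r : ℕ) + 1) ∪ A.image φ with hB
  rw [coeff_Th t ε ht (3 * n + r) B Finset.subset_union_left]
  have key : ∑ j ∈ B, (if t j = 3 * n + r then ε j else 0) =
      ∑ i ∈ A, if 3 * t i = n then ε i else 0 := by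
    symm
    refine Finset.sum_of_injOn φ hφ.injOn ?_ ?_ ?_
    · intro i hi
      exact Finset.mem_union_right _ (Finset.mem_image_of_mem _ hi)
    · intro j _ hj
      refine if_neg fun hjt => hj ?_
      obtain ⟨i, rfl⟩ := h1 j n hjt
      refine ⟨i, ?_, rfl⟩
      have a1 := h2 i
      have a2 := abs_le.1 (ht i)
      rw [hA]
      simp only [Finset.coe_Icc, Set.mem_Icc]
      omega
    · intro i _
      rw [h2, h3]
      by_cases h : 3 * t i = n
      · rw [if_pos h, if_pos (by omega)]
      · rw [if_neg h, if_neg (by omega)]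
  rw [key]
  split_ifs with hn
  · obtain ⟨k, rfl⟩ := hn
    rw [Nat.mul_div_cancel_left _ (by norm_num),
      coeff_Th t ε ht k A (Finset.Icc_subset_Icc (by omega) (by omega))]
    refine Finset.sum_congr rfl fun i _ => ?_
    simp
  · refine Finset.sum_eq_zero fun i _ => if_neg ?_
    rintro rfl
    exact hn (dvd_mul_right _ _)

/-! q-binomials -/

noncomputable def g (Q : S) : ℕ → ℕ → S
  | _, 0 => 1
  | 0, _ + 1 => 0
  | n + 1, k + 1 => g Q n k + Q ^ (k + 1) * g Q n (k + 1)

lemma g_zero_right (Q : S) (n : ℕ) : g Q n 0 = 1 := by cases n <;> rfl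

lemma g_succ (Q : S) (n k : ℕ) :
    g Q (n + 1) (k + 1) = g Q n k + Q ^ (k + 1) * g Q n (k + 1) := rfl

lemma g_lt (Q : S) (n k : ℕ) (h : n < k) : g Q n k = 0 := by
  induction n generalizing k with
  | zero => obtain ⟨k, rfl⟩ := Nat.exists_eq_succ_of_ne_zero (by omega : k ≠ 0); rfl
  | succ n ih =>
    obtain ⟨k, rfl⟩ := Nat.exists_eq_succ_of_ne_zero (by omega : k ≠ 0)
    rw [Nat.succ_eq_add_one, g_succ, ih k (by omega), ih (k + 1) (by omega)]; simp

lemma g_self (Q : S) (n : ℕ) : g Q n n = 1 := by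
  induction n with
  | zero => rfl
  | succ n ih => rw [g_succ, ih, g_lt Q n (n + 1) (by omega)]; simp

lemma e_succ (c n : ℕ) : e c (n + 1) = e c n * (1 - (X ^ c) ^ (n + 1)) := by
  rw [e, Finset.prod_range_succ, ← e]

lemma g_mul (c s : ℕ) : ∀ a b : ℕ, a + b = s → g (X ^ c) s a * e c a * e c b = e c s := by
  induction s with
  | zero =>
    intro a b h
    obtain ⟨rfl, rfl⟩ : a = 0 ∧ b = 0 := by omega
    simp [g, e]
  | succ s ih =>
    intro a b h
    rcases a with _ | a
    · obtain rfl : b = s + 1 := by omega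
      rw [g_zero_right]; simp [e]
    · rcases b with _ | b
      · obtain rfl : a = s := by omega
        rw [g_self]; simp [e]
      · have i1 := ih a (b + 1) (by omega)
        have i2 := ih (a + 1) b (by omega)
        obtain rfl : s = a + b + 1 := by omega
        rw [g_succ, e_succ c (a + b + 1)]
        rw [e_succ] at i1 i2 ⊢
        rw [e_succ c b]
        set q : S := X ^ c
        have : q ^ (a + b + 1 + 1) = q ^ (a + 1) * q ^ (b + 1) := by ring
        rw [this]
        linear_combination (1 - q ^ (a + 1)) * i1 + q ^ (a + 1) * (1 - q ^ (b + 1)) * i2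

lemma qbin (Q y : S) (n : ℕ) : ∀ z : S, ∏ i ∈ Finset.range n, (y + z * Q ^ i) =
    ∑ k ∈ Finset.range (n + 1), g Q n k * (Q ^ (k.choose 2) * z ^ k * y ^ (n - k)) := by
  induction n with
  | zero => intro z; simp [g]
  | succ n ih =>
    intro z
    rw [Finset.prod_range_succ']
    have : ∀ i, y + z * Q ^ (i + 1) = y + (z * Q) * Q ^ i := by intro i; ring
    simp only [this]
    rw [ih (z * Q), Finset.sum_range_succ' _ (n + 1)]
    simp only [g_succ, add_mul, Finset.sum_add_distrib]
    have h2 : ∑ k ∈ Finset.range (n + 1), Q ^ (k + 1) * g Q n (k + 1) *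
          (Q ^ ((k + 1).choose 2) * z ^ (k + 1) * y ^ (n + 1 - (k + 1))) +
        g Q (n + 1) 0 * (Q ^ (Nat.choose 0 2) * z ^ 0 * y ^ (n + 1 - 0)) =
        ∑ k ∈ Finset.range (n + 1), Q ^ k * g Q n k * (Q ^ (k.choose 2) * z ^ k * y ^ (n + 1 - k)) := by
      have := Finset.sum_range_succ' (fun k => Q ^ k * g Q n k *
        (Q ^ (k.choose 2) * z ^ k * y ^ (n + 1 - k))) (n + 1)
      rw [Finset.sum_range_succ, g_lt Q n (n + 1) (by omega)] at this
      simp only [g_zero_right] at this ⊢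
      simp only [mul_zero, zero_mul, add_zero] at this
      rw [this]; simp
    rw [add_assoc, h2, ← Finset.sum_add_distrib, Finset.sum_mul]
    refine Finset.sum_congr rfl fun k hk => ?_
    have hk' : n + 1 - k = n - k + 1 := by have := Finset.mem_range.1 hk; omega
    rw [hk', Nat.add_sub_add_right, show (k + 1).choose 2 = k + k.choose 2 by
      rw [Nat.choose_succ_succ' k 1]; simp]
    ring

lemma conv_g (c : ℕ) (hc : 0 < c) (j : ℤ) :
    Conv (fun n => f c * g (X ^ c) (2 * n) ((n : ℤ) + j).toNat) 1 := by
  have hw : Conv (fun n : ℕ => e c ((n : ℤ) + j).toNat * e c ((n : ℤ) - j).toNat) (f c * f c) :=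
    ((conv_e c hc).comp (fun n : ℕ => ((n : ℤ) + j).toNat) j.natAbs (by intro n; omega)).mul
      ((conv_e c hc).comp (fun n : ℕ => ((n : ℤ) - j).toNat) j.natAbs (by intro n; omega))
  refine Conv.cancel ((f_unit c).mul (f_unit c)) ?_ hw
  have h := (Conv.const (f c)).mul ((conv_e c hc).comp (fun n => 2 * n) 0 (by intro n; omega))
  rw [one_mul]
  refine h.congr j.natAbs fun n hn => ?_
  have := g_mul c (2 * n) ((n : ℤ) + j).toNat ((n : ℤ) - j).toNat (by omega)
  rw [← this]; ring

lemma reindex (F : ℕ → S) (n : ℕ) : ∑ k ∈ Finset.range (2 * n + 1), F k =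
    ∑ j ∈ Finset.Icc (-(n : ℤ)) n, F ((n : ℤ) + j).toNat := by
  refine Finset.sum_nbij' (fun k => (k : ℤ) - n) (fun j => ((n : ℤ) + j).toNat) ?_ ?_ ?_ ?_ ?_
  · intro k hk; simp only [Finset.mem_range, Finset.mem_Icc] at *; omega
  · intro k hk; simp only [Finset.mem_range, Finset.mem_Icc] at *; omega
  · intro k hk; simp only [Finset.mem_range] at *; omega
  · intro k hk; simp only [Finset.mem_Icc] at *; omega
  · intro k hk; simp

lemma choose_two_cast (k : ℕ) : 2 * (k.choose 2 : ℤ) = k * (k - 1) := by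
  induction k with
  | zero => simp
  | succ k ih =>
    rw [show (k + 1).choose 2 = k + k.choose 2 by rw [Nat.choose_succ_succ' k 1]; simp]
    push_cast
    linarith

def t1 (j : ℤ) : ℕ := (j * (j - 1) / 2).toNat
def t2 (j : ℤ) : ℕ := (j ^ 2).toNat

lemma t1_cast (j : ℤ) : 2 * (t1 j : ℤ) = j * (j - 1) := by
  have h1 : 0 ≤ j * (j - 1) := by
    rcases le_or_gt j 0 with h | h <;> nlinarith
  have h2 : Even (j * (j - 1)) := Int.even_mul_pred_self j
  obtain ⟨r, hr⟩ := h2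
  rw [t1, hr]; omega

lemma t2_cast (j : ℤ) : (t2 j : ℤ) = j ^ 2 := by
  rw [t2]; exact Int.toNat_of_nonneg (sq_nonneg j)

lemma t1_growth (j : ℤ) : |j| ≤ t1 j + 1 := by
  have := t1_cast j
  rw [abs_le]; constructor <;> nlinarith [sq_nonneg (j - 1), sq_nonneg (j - 2), sq_nonneg (j+1), sq_nonneg j]

lemma t2_growth (j : ℤ) : |j| ≤ t2 j + 1 := by
  have := t2_cast j
  rw [abs_le]; constructor <;> nlinarith [sq_nonneg (j - 1), sq_nonneg (j + 1), sq_nonneg j]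

noncomputable def B (n : ℕ) : S :=
  (∏ i ∈ Finset.range n, (1 + X ^ (i + 1))) * ∏ i ∈ Finset.range n, (1 + X ^ i)

lemma B_eq (n : ℕ) : B n = ∑ j ∈ Finset.Icc (-(n : ℤ)) n,
    g (X ^ 1) (2 * n) ((n : ℤ) + j).toNat * X ^ t1 j := by
  have hX : (X : S) ≠ 0 := X_ne_zero
  apply mul_left_cancel₀ (pow_ne_zero (n.choose 2 + n * n) hX)
  have h := qbin (X ^ 1 : S) (X ^ n) (2 * n) 1
  rw [reindex] at h
  have hl : ∏ i ∈ Finset.range (2 * n), (X ^ n + 1 * (X ^ 1) ^ i : S) = X ^ (n.choose 2 + n * n) * B n := by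
    rw [two_mul, Finset.prod_range_add, B, pow_add]
    have l1 : ∏ i ∈ Finset.range n, (X ^ n + 1 * (X ^ 1) ^ i : S) =
        X ^ (n.choose 2) * ∏ i ∈ Finset.range n, (1 + X ^ (i + 1)) := by
      rw [← Finset.prod_range_reflect (fun i => (1 + X ^ (i + 1) : S)),
        show n.choose 2 = ∑ i ∈ Finset.range n, i by rw [Finset.sum_range_id, Nat.choose_two_right], ← Finset.prod_pow_eq_pow_sum, ← Finset.prod_mul_distrib]
      refine Finset.prod_congr rfl fun i hi => ?_
      have := Finset.mem_range.1 hi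
      rw [mul_add, ← pow_add, show i + (n - 1 - i + 1) = n by omega]
      ring
    have l2 : ∏ i ∈ Finset.range n, (X ^ n + 1 * (X ^ 1) ^ (n + i) : S) =
        X ^ (n * n) * ∏ i ∈ Finset.range n, (1 + X ^ i) := by
      have : (X : S) ^ (n * n) = ∏ i ∈ Finset.range n, X ^ n := by simp [pow_mul]
      rw [this, ← Finset.prod_mul_distrib]
      refine Finset.prod_congr rfl fun i hi => ?_
      ring
    rw [l1, l2]; ring
  rw [← hl, h, Finset.mul_sum]
  refine Finset.sum_congr rfl fun j hj => ?_
  rw [Finset.mem_Icc] at hj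
  obtain ⟨k, hk⟩ : ∃ k : ℕ, (k : ℤ) = n + j := ⟨((n : ℤ) + j).toNat, by omega⟩
  rw [← hk, Int.toNat_natCast]
  rw [one_pow, mul_one, pow_one, mul_left_comm (X ^ _), ← pow_add, ← pow_mul, ← pow_add]
  congr 2
  have c1 := choose_two_cast k
  have c2 := choose_two_cast n
  have c3 := t1_cast j
  obtain ⟨l, hl⟩ : ∃ l : ℕ, 2 * n = k + l := ⟨2 * n - k, by omega⟩
  rw [hl, Nat.add_sub_cancel_left]
  have hl' : (l : ℤ) = n - j := by omega
  zify
  rw [hl']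
  rw [hk] at c1
  nlinarith

lemma B_mul (n : ℕ) : B n * e 1 n ^ 2 * (1 + X ^ n) = 2 * e 2 n ^ 2 := by
  have h1 : (∏ i ∈ Finset.range n, (1 + X ^ (i + 1) : S)) * e 1 n = e 2 n := by
    rw [e, e, ← Finset.prod_mul_distrib]
    refine Finset.prod_congr rfl fun i _ => ?_
    ring
  have h2 : (∏ i ∈ Finset.range n, (1 + X ^ i : S)) * (1 + X ^ n) =
      2 * ∏ i ∈ Finset.range n, (1 + X ^ (i + 1) : S) := by
    rw [← Finset.prod_range_succ (fun i => (1 + X ^ i : S)), Finset.prod_range_succ']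
    rw [pow_zero]; ring
  rw [B, ← h1]
  linear_combination (∏ i ∈ Finset.range n, (1 + X ^ (i + 1) : S)) * e 1 n ^ 2 * h2

lemma conv_X : Conv (fun n => 1 + X ^ n) 1 := by
  intro m
  refine ⟨m, fun n hn => ?_⟩
  rw [add_sub_cancel_left]
  exact pow_dvd_pow _ hn

lemma psi_eq : Th t1 (fun _ => 1) * f 1 = 2 * f 2 ^ 2 := by
  have h := tannery t1 (fun _ => 1) t1_growth _ (conv_g 1 one_pos)
  have h' : Conv (fun n => f 1 * B n) (Th t1 (fun _ => 1)) := by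
    refine h.congr 0 fun n _ => ?_
    rw [B_eq, Finset.mul_sum]
    refine Finset.sum_congr rfl fun j _ => ?_
    simp [mul_assoc]
  have h2 := (h'.mul ((conv_e 1 one_pos).pow 2)).mul conv_X
  have h3 := (Conv.const (f 1 * 2)).mul ((conv_e 2 two_pos).pow 2)
  have h4 : (fun n => f 1 * B n * e 1 n ^ 2 * (1 + X ^ n)) = fun n => f 1 * 2 * e 2 n ^ 2 := by
    funext n
    linear_combination f 1 * B_mul n
  rw [h4] at h2
  have h5 := h2.unique h3
  apply ((f_unit 1).mul_left_inj).1
  linear_combination h5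

lemma od_eq (n : ℕ) : od n ^ 2 = ∑ j ∈ Finset.Icc (-(n : ℤ)) n,
    g (X ^ 2) (2 * n) ((n : ℤ) + j).toNat * (C ((-1) ^ j.natAbs) * X ^ t2 j) := by
  have hX : (X : S) ≠ 0 := X_ne_zero
  have hm : ((-1 : S) ^ n) ≠ 0 := pow_ne_zero _ (by simp)
  apply mul_left_cancel₀ (mul_ne_zero hm (pow_ne_zero (n * n + 2 * n * n) hX))
  have h := qbin (X ^ 2 : S) (-X ^ (2 * n)) (2 * n) X
  rw [reindex] at h
  have hl : ∏ i ∈ Finset.range (2 * n), (-X ^ (2 * n) + X * (X ^ 2) ^ i : S) =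
      (-1) ^ n * X ^ (n * n + 2 * n * n) * od n ^ 2 := by
    rw [two_mul n, Finset.prod_range_add, ← two_mul, pow_add, sq (od n)]
    have l1 : ∏ i ∈ Finset.range n, (-X ^ (2 * n) + X * (X ^ 2) ^ i : S) =
        X ^ (n * n) * od n := by
      have : n * n = ∑ i ∈ Finset.range n, (2 * i + 1) := by
        clear * -
        induction n with
        | zero => rfl
        | succ n ih => rw [Finset.sum_range_succ, ← ih]; ring
      rw [od, ← Finset.prod_range_reflect (fun i => (1 - X ^ (2 * i + 1) : S)), this,
        ← Finset.prod_pow_eq_pow_sum, ← Finset.prod_mul_distrib]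
      refine Finset.prod_congr rfl fun i hi => ?_
      have := Finset.mem_range.1 hi
      rw [mul_sub, ← pow_add, show 2 * i + 1 + (2 * (n - 1 - i) + 1) = 2 * n by omega]
      ring
    have l2 : ∏ i ∈ Finset.range n, (-X ^ (2 * n) + X * (X ^ 2) ^ (n + i) : S) =
        (-1) ^ n * X ^ (2 * n * n) * od n := by
      have : (-1) ^ n * (X : S) ^ (2 * n * n) = ∏ i ∈ Finset.range n, (-X ^ (2 * n)) := by
        rw [Finset.prod_const, Finset.card_range, neg_pow (X ^ _), ← pow_mul]
      rw [this, od, ← Finset.prod_mul_distrib]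
      refine Finset.prod_congr rfl fun i hi => ?_
      ring
    rw [l1, l2]; ring
  rw [← hl, h, Finset.mul_sum]
  refine Finset.sum_congr rfl fun j hj => ?_
  rw [Finset.mem_Icc] at hj
  obtain ⟨k, hk⟩ : ∃ k : ℕ, (k : ℤ) = n + j := ⟨((n : ℤ) + j).toNat, by omega⟩
  rw [← hk, Int.toNat_natCast]
  obtain ⟨l, hl⟩ : ∃ l : ℕ, 2 * n = k + l := ⟨2 * n - k, by omega⟩
  have hl2 : 2 * n - k = l := by omega
  have hl' : (l : ℤ) = n - j := by omega
  rw [hl2, mul_left_comm, neg_pow, ← pow_mul, ← pow_mul]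
  have hs : (-1 : S) ^ l = (-1) ^ n * (-1) ^ j.natAbs := by
    rw [← pow_add]
    refine neg_one_pow_congr ?_
    rw [Nat.even_iff, Nat.even_iff]; omega
  have hx : 2 * k.choose 2 + k + 2 * n * l = n * n + 2 * n * n + t2 j := by
    have c1 := choose_two_cast k
    have c3 := t2_cast j
    zify
    rw [hl']
    rw [c3, c1, hk]; ring
  have hxx : (X : S) ^ (2 * k.choose 2) * X ^ k * X ^ (2 * n * l) =
      X ^ (n * n + 2 * n * n) * X ^ t2 j := by
    rw [← pow_add, ← pow_add, ← pow_add, hx]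
  have hC : (C ((-1 : ZMod 3) ^ j.natAbs) : S) = (-1) ^ j.natAbs := by simp
  rw [hC, hs]
  linear_combination g (X ^ 2) (2 * n) k * (-1) ^ n * (-1) ^ j.natAbs * hxx

lemma phi_eq : Th t2 (fun j => (-1) ^ j.natAbs) * f 2 = f 1 ^ 2 := by
  have h := tannery t2 (fun j => (-1) ^ j.natAbs) t2_growth _ (conv_g 2 two_pos)
  have h' : Conv (fun n => f 2 * od n ^ 2) (Th t2 (fun j => (-1) ^ j.natAbs)) := by
    refine h.congr 0 fun n _ => ?_
    rw [od_eq, Finset.mul_sum]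
    refine Finset.sum_congr rfl fun j _ => ?_
    rw [mul_assoc]
  have h2 := h'.mul ((conv_e 2 two_pos).pow 2)
  have h3 := (Conv.const (f 2)).mul
    (((conv_e 1 one_pos).comp (fun n => 2 * n) 0 (by intro n; omega)).pow 2)
  have h4 : (fun n => f 2 * od n ^ 2 * e 2 n ^ 2) = fun n => f 2 * e 1 (2 * n) ^ 2 := by
    funext n
    rw [← od_mul]; ring
  rw [h4] at h2
  have h5 := h2.unique h3
  apply ((f_unit 2).mul_left_inj).1
  linear_combination h5

lemma psi1 : U 1 (Th t1 (fun _ => 1)) = Th t1 (fun _ => 1) ^ 3 := by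
  refine U_Th _ _ t1_growth 1 (fun i => 3 * i - 1) (fun a b h => by simpa using h) ?_ ?_ (fun _ => rfl)
  · intro j n h
    have := t1_cast j
    rw [h] at this
    push_cast at this
    refine ⟨(j + 1) / 3, ?_⟩
    obtain ⟨m, hm | hm | hm⟩ : ∃ m, j = 3 * m ∨ j = 3 * m + 1 ∨ j = 3 * m + 2 := ⟨j / 3, by omega⟩
    all_goals subst hm
    · ring_nf at this; omega
    · ring_nf at this; omega
    · omega
  · intro i
    have h1 := t1_cast i
    have h2 := t1_cast (3 * i - 1)
    zify
    nlinarith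

lemma psi2 : U 2 (Th t1 (fun _ => 1)) = 0 := by
  refine U_Th_zero _ _ 2 fun j n h => ?_
  have := t1_cast j
  rw [h] at this
  push_cast at this
  obtain ⟨m, hm | hm | hm⟩ : ∃ m, j = 3 * m ∨ j = 3 * m + 1 ∨ j = 3 * m + 2 := ⟨j / 3, by omega⟩
  all_goals subst hm; ring_nf at this; omega

lemma phi0 : U 0 (Th t2 (fun j => (-1) ^ j.natAbs)) = Th t2 (fun j => (-1) ^ j.natAbs) ^ 3 := by
  refine U_Th _ _ t2_growth 0 (fun i => 3 * i) (fun a b h => by simpa using h) ?_ ?_ ?_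
  · intro j n h
    have := t2_cast j
    rw [h] at this
    push_cast at this
    refine ⟨j / 3, ?_⟩
    obtain ⟨m, hm | hm | hm⟩ : ∃ m, j = 3 * m ∨ j = 3 * m + 1 ∨ j = 3 * m + 2 := ⟨j / 3, by omega⟩
    all_goals subst hm
    · simp
    · ring_nf at this; omega
    · ring_nf at this; omega
  · intro i
    have h1 := t2_cast i
    have h2 := t2_cast (3 * i)
    zify
    rw [h1, h2]; ring
  · intro i
    refine neg_one_pow_congr ?_
    rw [Nat.even_iff, Nat.even_iff]; omega

lemma phi2 : U 2 (Th t2 (fun j => (-1) ^ j.natAbs)) = 0 := by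
  refine U_Th_zero _ _ 2 fun j n h => ?_
  have := t2_cast j
  rw [h] at this
  push_cast at this
  obtain ⟨m, hm | hm | hm⟩ : ∃ m, j = 3 * m ∨ j = 3 * m + 1 ∨ j = 3 * m + 2 := ⟨j / 3, by omega⟩
  all_goals subst hm; ring_nf at this; omega

end Pf

theorem stmt12 (n : ℕ) : a 8 (27 * n + 20) ≡ 0 [MOD 3] := by
  have h := Pf.core Pf.FF (Pf.f 1) (Pf.f 2) _ _ (Pf.f_unit 1) (Pf.f_unit 2) Pf.FF_eq Pf.psi_eq
    Pf.phi_eq Pf.psi1 Pf.psi2 Pf.phi0 Pf.phi2 n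
  rw [Pf.FF, PowerSeries.coeff_mk] at h
  exact (ZMod.natCast_eq_natCast_iff _ _ _).1 (by simpa using h)
end
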